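/- arXiv:1709.10371 — 7 statements merged into one kernel-verified Lean document; each statement's English description precedes it below -/
import Mathlib

section
/- Let (Ω, ℱ, P) be a probability space with a filtration (𝒢_m)_{m∈ℕ}, and let (I_m)_{m∈ℕ} be a martingale with respect to (𝒢_m) such that 0 ≤ I_m ≤ 1 almost surely for every m. Suppose there exist real constants α > 0 and β > 0 such that almost surely, for every m ∈ ℕ, |I_{m+1} − I_m| ≥ I_m^α · (1 − I_m)^β. Then there exists a random variable I_∞ such that I_m converges to I_∞ almost surely, I_∞ takes values in {0,1} almost surely, and P(I_∞ = 1) = E[I_0]. -/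
open MeasureTheory Filter

theorem polarization_martingale_limit
    {Ω : Type*} {m0 : MeasurableSpace Ω} (P : Measure Ω) [IsProbabilityMeasure P]
    (𝒢 : Filtration ℕ m0) (I : ℕ → Ω → ℝ)
    (hmart : Martingale I 𝒢 P)
    (hbdd : ∀ m, ∀ᵐ ω ∂P, 0 ≤ I m ω ∧ I m ω ≤ 1)
    (α β : ℝ) (hα : 0 < α) (hβ : 0 < β)
    (hgap : ∀ᵐ ω ∂P, ∀ m : ℕ,
      |I (m + 1) ω - I m ω| ≥ (I m ω) ^ α * (1 - I m ω) ^ β) :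
    ∃ Ilim : Ω → ℝ,
      (∀ᵐ ω ∂P, Tendsto (fun m => I m ω) atTop (nhds (Ilim ω))) ∧
      (∀ᵐ ω ∂P, Ilim ω = 0 ∨ Ilim ω = 1) ∧
      (P {ω | Ilim ω = 1}).toReal = ∫ ω, I 0 ω ∂P := by
  have hnorm : ∀ m, ∀ᵐ ω ∂P, ‖I m ω‖ ≤ 1 := by
    intro m
    filter_upwards [hbdd m] with ω h
    rw [Real.norm_eq_abs, abs_of_nonneg h.1]
    exact h.2
  have hL1 : ∀ n, eLpNorm (I n) 1 P ≤ ((1 : NNReal) : ENNReal) := by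
    intro n
    refine (eLpNorm_le_of_ae_bound (hnorm n)).trans ?_
    simp
  have hlim := hmart.submartingale.ae_tendsto_limitProcess hL1
  have hmeas : Measurable (Filtration.limitProcess I 𝒢 P) :=
    (Filtration.stronglyMeasurable_limit_process' (ℱ := 𝒢) (f := I) (μ := P)).measurable
  set L := Filtration.limitProcess I 𝒢 P with hL
  have h01 : ∀ᵐ ω ∂P, L ω = 0 ∨ L ω = 1 := by
    filter_upwards [hlim, hgap, ae_all_iff.2 hbdd] with ω hl hg hb
    have h0 : 0 ≤ L ω := ge_of_tendsto' hl fun m => (hb m).1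
    have h1 : L ω ≤ 1 := le_of_tendsto' hl fun m => (hb m).2
    have hd : Tendsto (fun m => |I (m + 1) ω - I m ω|) atTop (nhds |L ω - L ω|) :=
      (((tendsto_add_atTop_iff_nat 1).2 hl).sub hl).abs
    have hr : Tendsto (fun m => (I m ω) ^ α * (1 - I m ω) ^ β) atTop
        (nhds ((L ω) ^ α * (1 - L ω) ^ β)) :=
      (hl.rpow_const (Or.inr hα.le)).mul ((hl.const_sub 1).rpow_const (Or.inr hβ.le))
    have hle := le_of_tendsto_of_tendsto' hr hd hg
    rw [sub_self, abs_zero] at hle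
    by_contra! hne
    have ha : 0 < L ω := lt_of_le_of_ne h0 (Ne.symm hne.1)
    have hb' : 0 < 1 - L ω := sub_pos.2 (lt_of_le_of_ne h1 hne.2)
    have := mul_pos (Real.rpow_pos_of_pos ha α) (Real.rpow_pos_of_pos hb' β)
    linarith
  refine ⟨L, hlim, h01, ?_⟩
  have hint : Tendsto (fun n => ∫ ω, I n ω ∂P) atTop (nhds (∫ ω, L ω ∂P)) :=
    tendsto_integral_of_dominated_convergence (fun _ => (1 : ℝ))
      (fun n => (hmart.integrable n).aestronglyMeasurable) (integrable_const _) hnorm hlim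
  have hconst : ∀ n, ∫ ω, I n ω ∂P = ∫ ω, I 0 ω ∂P := by
    intro n
    have := hmart.setIntegral_eq (Nat.zero_le n) MeasurableSet.univ
    simpa using this.symm
  simp only [hconst] at hint
  rw [tendsto_nhds_unique tendsto_const_nhds hint]
  have hS : MeasurableSet {ω | L ω = 1} := hmeas (measurableSet_singleton 1)
  have : ∫ ω, L ω ∂P = ∫ ω, ({ω | L ω = 1}).indicator (1 : Ω → ℝ) ω ∂P := by
    refine integral_congr_ae ?_
    filter_upwards [h01] with ω h
    rcases h with h | h <;> simp [Set.indicator, h]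
  rw [this, integral_indicator_one hS]
  rfl
end

section
/- For every real number a with 0 ≤ a ≤ 1/2, h₂(a⋆a) − h₂(a) ≥ h₂(a)² · (1 − h₂(a)), where a⋆a = 2a(1−a). In particular h₂(a⋆a) − h₂(a) ≥ 0. -/
noncomputable def h2 (p : ℝ) : ℝ := -p * Real.logb 2 p - (1 - p) * Real.logb 2 (1 - p)

noncomputable def bconv (a b : ℝ) : ℝ := a * (1 - b) + b * (1 - a)

noncomputable def gG (x : ℝ) : ℝ := (1 + x) * Real.log (1 + x) + (1 - x) * Real.log (1 - x)

lemma gG_hasSum {x : ℝ} (hx : |x| < 1) :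
    HasSum (fun k : ℕ => (x ^ 2) ^ (k + 1) / ((2 * k + 1) * (k + 1))) (gG x) := by
  have e1 := (Real.hasSum_log_sub_log_of_abs_lt_one hx).mul_left x
  have hx2 : |x ^ 2| < 1 := by
    rw [abs_pow]
    exact pow_lt_one₀ (abs_nonneg x) hx (by norm_num)
  have e2 := Real.hasSum_pow_div_log_of_abs_lt_one hx2
  have e3 := e1.sub e2
  obtain ⟨h1, h2⟩ := abs_lt.mp hx
  have hl : Real.log (1 - x ^ 2) = Real.log (1 + x) + Real.log (1 - x) := by
    rw [← Real.log_mul (by linarith) (by linarith)]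
    congr 1; ring
  have : gG x = x * (Real.log (1 + x) - Real.log (1 - x)) - -Real.log (1 - x ^ 2) := by
    rw [hl, gG]; ring
  rw [this]
  refine e3.congr_fun ?_ |> fun h => h
  intro k
  have a1 : (2 * (k : ℝ) + 1) ≠ 0 := by positivity
  have a2 : ((k : ℝ) + 1) ≠ 0 := by positivity
  field_simp
  ring

lemma gG_lower {x : ℝ} (hx : |x| < 1) :
    x ^ 2 + (x ^ 2) ^ 2 / 6 + (x ^ 2) ^ 3 / 15 ≤ gG x := by
  have h := gG_hasSum hx
  have := sum_le_hasSum (Finset.range 3) (fun k _ => by positivity) h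
  simp only [Finset.sum_range_succ, Finset.sum_range_zero] at this
  norm_num at this
  linarith

lemma gG_upper {y : ℝ} (hy0 : 0 ≤ y) (hy : y ≤ 49 / 64) :
    gG y ≤ y ^ 2 * (1 + 41 / 100 * y ^ 2) := by
  have hx : |y| < 1 := by rw [abs_of_nonneg hy0]; linarith
  have h := gG_hasSum hx
  rw [← hasSum_nat_add_iff' 1] at h
  have hq : y ^ 2 ≤ (49 / 64) ^ 2 := by gcongr
  have hg := (hasSum_geometric_of_lt_one (r := y ^ 2) (by positivity) (by linarith)).mul_left
    (y ^ 4 / 6)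
  have hle := hasSum_le (fun k => by
    have hk : (0 : ℝ) ≤ k := Nat.cast_nonneg k
    have : (y ^ 2) ^ (k + 1 + 1) / ((2 * ((k + 1 : ℕ) : ℝ) + 1) * (((k + 1 : ℕ) : ℝ) + 1))
        ≤ (y ^ 4 / 6) * (y ^ 2) ^ k := by
      have e : (y ^ 4 / 6) * (y ^ 2) ^ k = (y ^ 2) ^ (k + 1 + 1) / 6 := by ring
      rw [e]
      apply div_le_div_of_nonneg_left (by positivity) (by norm_num)
      push_cast
      nlinarith
    exact this) h hg
  simp at hle
  have hinv : (1 - y ^ 2)⁻¹ ≤ 246 / 100 := by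
    rw [inv_le_comm₀ (by linarith) (by norm_num)]
    norm_num at hq ⊢
    linarith
  have : y ^ 4 / 6 * (1 - y ^ 2)⁻¹ ≤ y ^ 4 / 6 * (246 / 100) := by gcongr
  nlinarith

lemma h2_eq_bin (a : ℝ) : h2 a = Real.binEntropy a / Real.log 2 := by
  rw [h2, Real.binEntropy_eq_negMulLog_add_negMulLog_one_sub, Real.negMulLog, Real.negMulLog,
    Real.logb, Real.logb]
  ring

lemma h2_nonneg {a : ℝ} (h0 : 0 ≤ a) (h1 : a ≤ 1) : 0 ≤ h2 a := by
  rw [h2_eq_bin]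
  exact div_nonneg (Real.binEntropy_nonneg h0 h1) (Real.log_nonneg (by norm_num))

lemma h2_le_one (a : ℝ) : h2 a ≤ 1 := by
  rw [h2_eq_bin]
  exact div_le_one_of_le₀ Real.binEntropy_le_log_two (Real.log_nonneg (by norm_num))

lemma h2_eq_gG {x : ℝ} (hx : |x| < 1) : h2 ((1 - x) / 2) = 1 - 1 / (2 * Real.log 2) * gG x := by
  obtain ⟨h1, h2'⟩ := abs_lt.mp hx
  have hl : Real.log 2 ≠ 0 := by positivity
  have e : 1 - (1 - x) / 2 = (1 + x) / 2 := by ring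
  rw [h2, e, Real.logb, Real.logb, Real.log_div (by linarith) (by norm_num),
    Real.log_div (by linarith) (by norm_num), gG]
  field_simp
  ring

lemma mid_poly {y : ℝ} (h0 : 0 ≤ y) (h1 : y ≤ 49 / 64) :
    0 ≤ 2 * (7213 / 10000) ^ 2 * (1 + y / 6 + y ^ 2 / 15) ^ 2
      - (7213 / 10000) ^ 3 * y * (1 + y / 6 + y ^ 2 / 15) ^ 3
      - 7214 / 10000 * (1 + 41 / 100 * y ^ 2) := by
  have hs : 0 ≤ 49 / 64 - y := by linarith
  have p0 : 0 ≤ (49 / 64 - y) ^ 7 := by positivity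
  have p1 : 0 ≤ y * (49 / 64 - y) ^ 6 := by positivity
  have p2 : 0 ≤ y ^ 2 * (49 / 64 - y) ^ 5 := by positivity
  have p3 : 0 ≤ y ^ 3 * (49 / 64 - y) ^ 4 := by positivity
  have p4 : 0 ≤ y ^ 4 * (49 / 64 - y) ^ 3 := by positivity
  have p5 : 0 ≤ y ^ 5 * (49 / 64 - y) ^ 2 := by positivity
  have p6 : 0 ≤ y ^ 6 * (49 / 64 - y) := by positivity
  have p7 : 0 ≤ y ^ 7 := by positivity
  ring_nf at *
  linarith

lemma mid_case {a : ℝ} (h0 : 1 / 16 ≤ a) (h1 : a ≤ 1 / 2) :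
    h2 (bconv a a) - h2 a ≥ (h2 a) ^ 2 * (1 - h2 a) := by
  obtain ⟨x, rfl⟩ : ∃ x, a = (1 - x) / 2 := ⟨1 - 2 * a, by ring⟩
  have hx0 : 0 ≤ x := by linarith
  have hx1 : x ≤ 7 / 8 := by linarith
  have hx : |x| < 1 := by rw [abs_of_nonneg hx0]; linarith
  have eb : bconv ((1 - x) / 2) ((1 - x) / 2) = (1 - x ^ 2) / 2 := by rw [bconv]; ring
  have hnn := h2_nonneg (a := (1 - x) / 2) (by linarith) (by linarith)
  rw [eb]
  have hlo := gG_lower hx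
  have hE := h2_eq_gG hx
  obtain ⟨y, hy⟩ : ∃ y, y = x ^ 2 := ⟨_, rfl⟩
  rw [← hy] at hlo ⊢
  have hy0 : 0 ≤ y := by rw [hy]; positivity
  have hy1 : y ≤ 49 / 64 := by rw [hy]; nlinarith
  have hya : |y| < 1 := by rw [abs_of_nonneg hy0]; linarith
  have hup := gG_upper hy0 hy1
  rw [hE] at hnn
  rw [h2_eq_gG hya, hE]
  have l1 := Real.log_two_gt_d9
  have l2 := Real.log_two_lt_d9
  have k1 : 7213 / 10000 ≤ 1 / (2 * Real.log 2) := by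
    rw [le_div_iff₀ (by linarith)]; linarith
  have k2 : 1 / (2 * Real.log 2) ≤ 7214 / 10000 := by
    rw [div_le_iff₀ (by linarith)]; linarith
  set κ := 1 / (2 * Real.log 2)
  have hP : 0 ≤ 1 + y / 6 + y ^ 2 / 15 := by positivity
  have hL : 7213 / 10000 * (y * (1 + y / 6 + y ^ 2 / 15)) ≤ κ * gG x := by
    apply mul_le_mul k1 (by linarith) (by positivity) (by linarith)
  have hU : κ * gG y ≤ 7214 / 10000 * (y ^ 2 * (1 + 41 / 100 * y ^ 2)) := by
    calc κ * gG y ≤ κ * (y ^ 2 * (1 + 41 / 100 * y ^ 2)) :=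
          mul_le_mul_of_nonneg_left hup (by linarith)
      _ ≤ _ := mul_le_mul_of_nonneg_right k2 (by positivity)
  have hpoly := mul_nonneg (sq_nonneg y) (mid_poly hy0 hy1)
  have hL0 : 0 ≤ 7213 / 10000 * (y * (1 + y / 6 + y ^ 2 / 15)) := by positivity
  have hpoly' : 7214 / 10000 * (y ^ 2 * (1 + 41 / 100 * y ^ 2)) ≤
      2 * (7213 / 10000 * (y * (1 + y / 6 + y ^ 2 / 15))) ^ 2
      - (7213 / 10000 * (y * (1 + y / 6 + y ^ 2 / 15))) ^ 3 := by
    nlinarith only [hpoly]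
  generalize 7213 / 10000 * (y * (1 + y / 6 + y ^ 2 / 15)) = L at *
  generalize κ * gG x = g at *
  have hg1 : g ≤ 1 := by linarith
  have q : 0 ≤ 2 * (g + L) - g ^ 2 - g * L - L ^ 2 := by nlinarith
  have := mul_nonneg (sub_nonneg.mpr hL) q
  nlinarith only [this, hU, hpoly']

lemma small_case {a : ℝ} (h0 : 0 < a) (h1 : a ≤ 1 / 16) :
    h2 (bconv a a) - h2 a ≥ (h2 a) ^ 2 * (1 - h2 a) := by
  have hb : bconv a a = 2 * (a * (1 - a)) := by rw [bconv]; ring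
  have l1 := Real.log_two_gt_d9
  have l2 := Real.log_two_lt_d9
  have hnn := h2_nonneg (a := a) (by linarith) (by linarith)
  have hpos : (0 : ℝ) < Real.log 2 := by linarith
  obtain ⟨l, hl⟩ : ∃ l, l = -Real.log a := ⟨_, rfl⟩
  obtain ⟨b, hbd⟩ : ∃ b, b = 2 * (a * (1 - a)) := ⟨_, rfl⟩
  have hb0 : 0 < b := by rw [hbd]; nlinarith
  have hb1 : b < 1 := by rw [hbd]; nlinarith
  -- upper bound on the entropy of a
  have hA : h2 a * Real.log 2 ≤ a * (l + 1) := by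
    have : h2 a * Real.log 2 = a * l - (1 - a) * Real.log (1 - a) := by
      rw [h2, Real.logb, Real.logb, hl]; field_simp
    rw [this]
    have := Real.one_sub_inv_le_log_of_pos (show 0 < 1 - a by linarith)
    have h3 := mul_le_mul_of_nonneg_left this (show 0 ≤ 1 - a by linarith)
    have h4 : (1 - a) * (1 - (1 - a)⁻¹) = -a := by
      have : 1 - a ≠ 0 := by linarith
      field_simp; ring
    linarith
  have hB : b * (l - Real.log 2 + a) + (1 - b) * b ≤ h2 b * Real.log 2 := by
    have lb : Real.log b = Real.log 2 - l + Real.log (1 - a) := by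
      rw [hbd, Real.log_mul (by norm_num) (by nlinarith),
        Real.log_mul (by linarith) (by linarith), hl]; ring
    have : h2 b * Real.log 2 = b * (l - Real.log 2 - Real.log (1 - a))
        - (1 - b) * Real.log (1 - b) := by
      rw [h2, Real.logb, Real.logb, lb]; field_simp; ring
    rw [this]
    have c1 := Real.log_le_sub_one_of_pos (show 0 < 1 - a by linarith)
    have c2 := Real.log_le_sub_one_of_pos (show 0 < 1 - b by linarith)
    nlinarith
  have hl1 : 4 * Real.log 2 ≤ l := by
    have := Real.log_le_log h0 h1
    have e : Real.log (1 / 16) = -(4 * Real.log 2) := by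
      rw [show (1 / 16 : ℝ) = (2 ^ 4)⁻¹ by norm_num, Real.log_inv, Real.log_pow]; norm_num
    linarith
  have hsq : a * (l + 1) ^ 2 ≤ 9 / 10 := by
    obtain ⟨s, hs⟩ : ∃ s, s = Real.sqrt a := ⟨_, rfl⟩
    have hs0 : 0 < s := by rw [hs]; positivity
    have hss : s ^ 2 = a := by rw [hs]; exact Real.sq_sqrt h0.le
    have hs1 : s ≤ 1 / 4 := by nlinarith
    have hll : l = 2 * Real.log (1 / (4 * s)) + 4 * Real.log 2 := by
      rw [hl, ← hss, Real.log_pow, one_div, Real.log_inv,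
        Real.log_mul (by norm_num) hs0.ne', show (4 : ℝ) = 2 ^ 2 by norm_num, Real.log_pow]
      push_cast; ring
    have c := Real.log_le_sub_one_of_pos (show 0 < 1 / (4 * s) by positivity)
    have c2 : l ≤ 2 * (1 / (4 * s) - 1) + 4 * Real.log 2 := by linarith
    have c3 : s * (l + 1) ≤ 1 / 2 + s * (4 * Real.log 2 - 1) := by
      have := mul_le_mul_of_nonneg_left c2 hs0.le
      have e : s * (2 * (1 / (4 * s) - 1) + 4 * Real.log 2)
        = 1 / 2 + s * (4 * Real.log 2 - 2) := by field_simp; ring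
      linarith
    have c4 : s * (l + 1) ≤ 944 / 1000 := by nlinarith
    have c5 : 0 ≤ s * (l + 1) := mul_nonneg hs0.le (by linarith)
    rw [← hss]
    nlinarith
  have key : (a * (l + 1)) ^ 2 ≤ Real.log 2 *
      (b * (l - Real.log 2 + a) + (1 - b) * b - a * (l + 1)) := by
    have e1 : (a * (l + 1)) ^ 2 = a * (a * (l + 1) ^ 2) := by ring
    have e2 : Real.log 2 * (b * (l - Real.log 2 + a) + (1 - b) * b - a * (l + 1))
      = a * (Real.log 2 * (2 * (1 - a) * (l - Real.log 2 + a + 1 - b) - l - 1)) := by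
      rw [hbd]; ring
    rw [e1, e2]
    apply mul_le_mul_of_nonneg_left _ h0.le
    have hb2 : b ≤ 2 * a := by rw [hbd]; nlinarith
    have d1 : 0.306 - 1/16 ≤ 1 - Real.log 2 + a - b := by linarith
    have d2 : 2.77 ≤ l := by linarith
    have d3 : 14 / 10 ≤ 2 * (1 - a) * (l - Real.log 2 + a + 1 - b) - l - 1 := by nlinarith
    nlinarith
  rw [hb, ← hbd]
  -- conclude
  have hH0 : 0 ≤ h2 a * Real.log 2 := by positivity
  have f1 : (h2 a * Real.log 2) ^ 2 ≤ (a * (l + 1)) ^ 2 := by gcongr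
  have f2 : (h2 a * Real.log 2) ^ 2 ≤ Real.log 2 * (h2 b * Real.log 2 - h2 a * Real.log 2) := by
    refine f1.trans (key.trans ?_)
    apply mul_le_mul_of_nonneg_left _ hpos.le
    linarith
  have f3 : h2 a ^ 2 ≤ h2 b - h2 a := by
    have : Real.log 2 ^ 2 * h2 a ^ 2 ≤ Real.log 2 ^ 2 * (h2 b - h2 a) := by nlinarith
    exact le_of_mul_le_mul_left this (by positivity)
  have f4 : 0 ≤ h2 a ^ 3 := by positivity
  nlinarith

theorem entropy_selfconv_gap (a : ℝ) (h0 : 0 ≤ a) (h1 : a ≤ 1 / 2) :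
    h2 (bconv a a) - h2 a ≥ (h2 a) ^ 2 * (1 - h2 a) ∧
    h2 (bconv a a) - h2 a ≥ 0 := by
  have main : h2 (bconv a a) - h2 a ≥ (h2 a) ^ 2 * (1 - h2 a) := by
    rcases h0.eq_or_lt with rfl | hpos
    · simp [h2, bconv]
    · rcases le_total a (1 / 16) with h | h
      · exact small_case hpos h
      · exact mid_case h h1
  refine ⟨main, le_trans ?_ main⟩
  exact mul_nonneg (sq_nonneg _) (by linarith [h2_le_one a])
end

section
/- For all real numbers a, b with 0 ≤ a ≤ 1/2 and 0 ≤ b ≤ 1/2, h₂(a⋆b) − h₂(b) ≥ h₂(a)² · (1 − h₂(b)). -/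
open Real Set in
lemma aux_m (a : ℝ) (h0 : 0 < a) (h1 : a ≤ 1 / 2) :
    0 ≤ (1 - a) * log (1 - a) - a * log a := by
  have hc : ConcaveOn ℝ (Icc (0:ℝ) (1/2)) (fun a => (1 - a) * log (1 - a) - a * log a) := by
    have hd : ∀ x ∈ Ioo (0:ℝ) (1/2), HasDerivAt (fun a : ℝ => (1 - a) * log (1 - a) - a * log a)
        (- log (1 - x) - log x - 2) x := by
      intro x hx
      have hx1 : (1:ℝ) - x ≠ 0 := by linarith [hx.2]
      have hx0 : x ≠ 0 := hx.1.ne'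
      have e1 : HasDerivAt (fun a : ℝ => 1 - a) (-1) x := by
        simpa using (hasDerivAt_id x).const_sub 1
      have e2 := (e1.mul (e1.log hx1)).sub ((hasDerivAt_id x).mul ((hasDerivAt_id x).log hx0))
      refine e2.congr_deriv ?_
      simp only [id]
      field_simp
      ring
    have hd2 : ∀ x ∈ Ioo (0:ℝ) (1/2), HasDerivAt (fun x : ℝ => - log (1 - x) - log x - 2)
        (1 / (1 - x) - 1 / x) x := by
      intro x hx
      have hx1 : (1:ℝ) - x ≠ 0 := by linarith [hx.2]
      have hx0 : x ≠ 0 := hx.1.ne'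
      have e1 : HasDerivAt (fun a : ℝ => 1 - a) (-1) x := by
        simpa using (hasDerivAt_id x).const_sub 1
      have e2 := (((e1.log hx1).neg).sub ((hasDerivAt_id x).log hx0)).sub_const 2
      refine e2.congr_deriv ?_
      simp only [id]
      field_simp
    refine concaveOn_of_hasDerivWithinAt2_nonpos (convex_Icc _ _)
      (f' := fun x => - log (1 - x) - log x - 2) (f'' := fun x => 1 / (1 - x) - 1 / x) ?_ ?_ ?_ ?_
    · have c := Real.continuous_mul_log
      exact ((c.comp (continuous_const.sub continuous_id)).sub c).continuousOn
    · rw [interior_Icc]; exact fun x hx => (hd x hx).hasDerivWithinAt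
    · rw [interior_Icc]; exact fun x hx => (hd2 x hx).hasDerivWithinAt
    · rw [interior_Icc]; intro x hx
      have : 1 / (1 - x) ≤ 1 / x := one_div_le_one_div_of_le hx.1 (by linarith [hx.2])
      linarith
  have h := hc.2 (by norm_num : (0:ℝ) ∈ Icc (0:ℝ) (1/2))
    (by norm_num : (1/2:ℝ) ∈ Icc (0:ℝ) (1/2))
    (by linarith : 0 ≤ 1 - 2 * a) (by linarith : 0 ≤ 2 * a) (by ring)
  norm_num at h
  have e : 2 * a * (1/2) = a := by ring
  rw [e] at h
  linarith

open Real Set in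
lemma aux_H (a : ℝ) (h0 : 0 ≤ a) (h1 : a ≤ 1 / 2) :
    binEntropy a ^ 2 ≤ 4 * a * (1 - a) * log 2 ^ 2 := by
  rcases h0.eq_or_lt with rfl | h0
  · simp
  have hm : MonotoneOn (fun a => binEntropy a ^ 2 / (a * (1 - a))) (Ioc (0:ℝ) (1/2)) := by
    have hd : ∀ x ∈ Ioc (0:ℝ) (1/2), HasDerivAt (fun a => binEntropy a ^ 2 / (a * (1 - a)))
        (binEntropy x * ((1 - x) * log (1 - x) - x * log x) / (x * (1 - x)) ^ 2) x := by
      intro x hx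
      have hx1 : (1:ℝ) - x ≠ 0 := by linarith [hx.2]
      have hx0 : x ≠ 0 := hx.1.ne'
      have e1 : HasDerivAt (fun a : ℝ => 1 - a) (-1) x := by
        simpa using (hasDerivAt_id x).const_sub 1
      have e2 := ((hasDerivAt_binEntropy hx0 (fun h => hx1 (by rw [h]; ring))).pow 2).div
        ((hasDerivAt_id x).mul e1) (mul_ne_zero hx0 hx1)
      refine e2.congr_deriv ?_
      simp only [id, Pi.mul_apply, Pi.pow_apply]
      congr 1
      have : binEntropy x = - x * log x - (1 - x) * log (1 - x) := by
        rw [binEntropy, log_inv, log_inv]; ring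
      rw [this]; push_cast; ring
    refine monotoneOn_of_hasDerivWithinAt_nonneg (convex_Ioc _ _)
      (fun x hx => (hd x hx).continuousAt.continuousWithinAt)
      (fun x hx => (hd x (interior_subset hx)).hasDerivWithinAt) ?_
    intro x hx
    have hx := interior_subset hx
    have := aux_m x hx.1 hx.2
    have := binEntropy_nonneg hx.1.le (by linarith [hx.2])
    positivity
  have h := hm ⟨h0, h1⟩ (by norm_num : (1/2:ℝ) ∈ Ioc (0:ℝ) (1/2)) h1
  have e : binEntropy (1/2) = log 2 := by
    rw [one_div]; exact binEntropy_two_inv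
  simp only [e] at h
  have : 0 < a * (1 - a) := mul_pos h0 (by linarith)
  rw [div_le_iff₀ this] at h
  refine h.trans_eq ?_
  norm_num
  ring

open Real Set in
lemma aux_P (t : ℝ) (h0 : 0 ≤ t) (h1 : t < 1) :
    0 ≤ -(2 + t) * log (1 + t) - (2 - t) * log (1 - t) := by
  have e1 : ∀ x : ℝ, HasDerivAt (fun a : ℝ => 1 - a) (-1) x := fun x => by
    simpa using (hasDerivAt_id x).const_sub 1
  have e1' : ∀ x : ℝ, HasDerivAt (fun a : ℝ => 1 + a) 1 x := fun x => by
    simpa using (hasDerivAt_id x).const_add 1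
  have e2 : ∀ x : ℝ, HasDerivAt (fun a : ℝ => 2 - a) (-1) x := fun x => by
    simpa using (hasDerivAt_id x).const_sub 2
  have e2' : ∀ x : ℝ, HasDerivAt (fun a : ℝ => -(2 + a)) (-1) x := fun x => by
    exact ((hasDerivAt_id x).const_add 2).neg
  have hd2 : ∀ x ∈ Ico (0:ℝ) 1, HasDerivAt
      (fun x : ℝ => log (1 - x) - log (1 + x) + 1 / (1 - x) - 1 / (1 + x))
      (4 * x ^ 2 / ((1 - x) * (1 + x)) ^ 2) x := by
    intro x hx
    have hx1 : (1:ℝ) - x ≠ 0 := by linarith [hx.2]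
    have hx0 : (1:ℝ) + x ≠ 0 := by linarith [hx.1]
    have := ((((e1 x).log hx1).sub ((e1' x).log hx0)).add
      ((hasDerivAt_const x (1:ℝ)).div (e1 x) hx1)).sub ((hasDerivAt_const x (1:ℝ)).div (e1' x) hx0)
    refine this.congr_deriv ?_
    field_simp
    ring
  have m2 : MonotoneOn (fun x : ℝ => log (1 - x) - log (1 + x) + 1 / (1 - x) - 1 / (1 + x))
      (Ico 0 1) := by
    refine monotoneOn_of_hasDerivWithinAt_nonneg (convex_Ico _ _)
      (fun x hx => (hd2 x hx).continuousAt.continuousWithinAt)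
      (fun x hx => (hd2 x (interior_subset hx)).hasDerivWithinAt) ?_
    intro x hx
    positivity
  have hd : ∀ x ∈ Ico (0:ℝ) 1, HasDerivAt
      (fun t : ℝ => -(2 + t) * log (1 + t) - (2 - t) * log (1 - t))
      (log (1 - x) - log (1 + x) + 1 / (1 - x) - 1 / (1 + x)) x := by
    intro x hx
    have hx1 : (1:ℝ) - x ≠ 0 := by linarith [hx.2]
    have hx0 : (1:ℝ) + x ≠ 0 := by linarith [hx.1]
    have := ((e2' x).mul ((e1' x).log hx0)).sub ((e2 x).mul ((e1 x).log hx1))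
    refine this.congr_deriv ?_
    field_simp
    ring
  have m1 : MonotoneOn (fun t : ℝ => -(2 + t) * log (1 + t) - (2 - t) * log (1 - t))
      (Ico 0 1) := by
    refine monotoneOn_of_hasDerivWithinAt_nonneg (convex_Ico _ _)
      (fun x hx => (hd x hx).continuousAt.continuousWithinAt)
      (fun x hx => (hd x (interior_subset hx)).hasDerivWithinAt) ?_
    intro x hx
    have hx := interior_subset hx
    have := m2 (by norm_num : (0:ℝ) ∈ Ico (0:ℝ) 1) hx hx.1
    simpa using this
  have := m1 (by norm_num : (0:ℝ) ∈ Ico (0:ℝ) 1) ⟨h0, h1⟩ h0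
  simpa using this

open Real Set in
lemma aux_G (x y : ℝ) (hx0 : 0 ≤ x) (hx1 : x ≤ 1) (hy0 : 0 ≤ y) (hy1 : y ≤ 1) :
    (1 + x * y) * log (1 + x * y) + (1 - x * y) * log (1 - x * y) ≤
      x ^ 2 * ((1 + y) * log (1 + y) + (1 - y) * log (1 - y)) := by
  rcases hx0.eq_or_lt with rfl | hx0
  · simp
  rcases hy0.eq_or_lt with rfl | hy0
  · simp
  have e1 : ∀ x : ℝ, HasDerivAt (fun a : ℝ => 1 - a) (-1) x := fun x => by
    simpa using (hasDerivAt_id x).const_sub 1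
  have e1' : ∀ x : ℝ, HasDerivAt (fun a : ℝ => 1 + a) 1 x := fun x => by
    simpa using (hasDerivAt_id x).const_add 1
  have hm : MonotoneOn (fun t : ℝ => ((1 + t) * log (1 + t) + (1 - t) * log (1 - t)) / t ^ 2)
      (Ioc 0 1) := by
    have hd : ∀ x ∈ Ioo (0:ℝ) 1, HasDerivAt
        (fun t : ℝ => ((1 + t) * log (1 + t) + (1 - t) * log (1 - t)) / t ^ 2)
        ((-(2 + x) * log (1 + x) - (2 - x) * log (1 - x)) / x ^ 3) x := by
      intro x hx
      have hx1 : (1:ℝ) - x ≠ 0 := by linarith [hx.2]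
      have hx0 : (1:ℝ) + x ≠ 0 := by linarith [hx.1]
      have hx2 : x ≠ 0 := hx.1.ne'
      have := (((e1' x).mul ((e1' x).log hx0)).add ((e1 x).mul ((e1 x).log hx1))).div
        ((hasDerivAt_id x).pow 2) (pow_ne_zero 2 hx2)
      refine this.congr_deriv ?_
      simp only [id, Pi.mul_apply, Pi.pow_apply, Pi.add_apply]
      field_simp
      push_cast
      ring
    have hi : interior (Ioc (0:ℝ) 1) = Ioo 0 1 := interior_Ioc
    refine monotoneOn_of_hasDerivWithinAt_nonneg (convex_Ioc _ _) ?_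
      (fun x hx => (hd x (hi ▸ hx)).hasDerivWithinAt) ?_
    · have c := Real.continuous_mul_log
      refine ContinuousOn.div ((c.comp (continuous_const.add continuous_id)).add
        (c.comp (continuous_const.sub continuous_id))).continuousOn (by fun_prop) ?_
      intro x hx
      exact pow_ne_zero 2 hx.1.ne'
    intro x hx
    rw [hi] at hx
    have h := aux_P x hx.1.le hx.2
    have := hx.1
    positivity
  have hxy : 0 < x * y := mul_pos hx0 hy0
  have hle : x * y ≤ y := by nlinarith
  have h := hm ⟨hxy, hle.trans hy1⟩ ⟨hy0, hy1⟩ hle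
  simp only at h
  rw [div_le_iff₀ (by positivity)] at h
  refine h.trans_eq ?_
  field_simp

open Real in
lemma aux_link (p : ℝ) (h0 : 0 ≤ p) (h1 : p < 1) :
    (1 + (1 - 2 * p)) * log (1 + (1 - 2 * p)) + (1 - (1 - 2 * p)) * log (1 - (1 - 2 * p)) =
      2 * (log 2 - binEntropy p) := by
  have a1 : 1 + (1 - 2 * p) = 2 * (1 - p) := by ring
  have a2 : 1 - (1 - 2 * p) = 2 * p := by ring
  rw [a1, a2, binEntropy, log_inv, log_inv, log_mul two_ne_zero (by linarith)]
  rcases h0.eq_or_lt with rfl | h0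
  · simp
  rw [log_mul two_ne_zero h0.ne']
  ring

lemma aux_h2 (p : ℝ) : h2 p = Real.binEntropy p / Real.log 2 := by
  rw [h2, Real.binEntropy, Real.log_inv, Real.log_inv, Real.logb, Real.logb]
  ring

theorem entropy_conv_gap_two_vars (a b : ℝ)
    (ha0 : 0 ≤ a) (ha1 : a ≤ 1 / 2) (hb0 : 0 ≤ b) (hb1 : b ≤ 1 / 2) :
    h2 (bconv a b) - h2 b ≥ (h2 a) ^ 2 * (1 - h2 b) := by
  have hL : 0 < Real.log 2 := Real.log_pos (by norm_num)
  have hc0 : 0 ≤ bconv a b := by unfold bconv; nlinarith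
  have hc1 : bconv a b < 1 := by unfold bconv; nlinarith
  have hG := aux_G (1 - 2 * a) (1 - 2 * b) (by linarith) (by linarith) (by linarith) (by linarith)
  have e : (1 - 2 * a) * (1 - 2 * b) = 1 - 2 * bconv a b := by unfold bconv; ring
  rw [e, aux_link _ hc0 hc1, aux_link b hb0 (by linarith)] at hG
  have hH := aux_H a ha0 ha1
  have hb : Real.binEntropy b ≤ Real.log 2 := Real.binEntropy_le_log_two
  have k1 : 0 ≤ 1 - h2 b := by
    rw [aux_h2, sub_nonneg, div_le_one hL]; exact hb
  have k2 : h2 a ^ 2 ≤ 4 * a * (1 - a) := by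
    rw [aux_h2, div_pow, div_le_iff₀ (by positivity)]; exact hH
  have k3 : 1 - h2 (bconv a b) ≤ (1 - 2 * a) ^ 2 * (1 - h2 b) := by
    have f1 : ∀ p, 1 - h2 p = (Real.log 2 - Real.binEntropy p) / Real.log 2 := by
      intro p; rw [aux_h2]; field_simp
    rw [f1, f1, ← mul_div_assoc]
    exact div_le_div_of_nonneg_right (by linarith) hL.le
  have k4 := mul_le_mul_of_nonneg_right k2 k1
  nlinarith
end

section
/- Let Y be a finite type, let P : Y → ℝ be a probability mass function (P(y) ≥ 0 for all y and ∑_y P(y) = 1), let q : Y → [0,1], and let a, b ∈ [0,1/2] be such that h₂(a) = ∑_y P(y)·h₂(q(y)). Then ∑_y P(y)·h₂(q(y)⋆b) ≥ h₂(a⋆b). -/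
noncomputable def mgA (t : ℝ) : ℝ := Real.log (1 + t) - Real.log (1 - t)

noncomputable def mgE (t : ℝ) : ℝ := Real.binEntropy ((1 - t) / 2)

theorem mgA_deriv {t : ℝ} (h0 : -1 < t) (h1 : t < 1) :
    HasDerivAt mgA (2 / (1 - t ^ 2)) t := by
  have e1 : (1 + t) ≠ 0 := by linarith
  have e2 : (1 - t) ≠ 0 := by linarith
  have e3 : (1 - t ^ 2) ≠ 0 := by
    have : 1 - t ^ 2 = (1 + t) * (1 - t) := by ring
    rw [this]; exact mul_ne_zero e1 e2
  have a1 : HasDerivAt (fun x : ℝ => 1 + x) 1 t := (hasDerivAt_id t).const_add 1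
  have a2 : HasDerivAt (fun x : ℝ => 1 - x) (-1) t := (hasDerivAt_id t).const_sub 1
  have := (a1.log e1).sub (a2.log e2)
  refine this.congr_deriv ?_
  have : 1 - t ^ 2 = (1 + t) * (1 - t) := by ring
  rw [this]
  field_simp
  ring

theorem mgE_deriv {t : ℝ} (h0 : -1 < t) (h1 : t < 1) :
    HasDerivAt mgE (-(mgA t) / 2) t := by
  have a2 : HasDerivAt (fun x : ℝ => (1 - x) / 2) (-1 / 2) t :=
    ((hasDerivAt_id t).const_sub 1).div_const 2
  have hb := Real.hasDerivAt_binEntropy (p := (1 - t) / 2) (by linarith) (by linarith)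
  have := HasDerivAt.comp t hb a2
  refine this.congr_deriv ?_
  have e : 1 - (1 - t) / 2 = (1 + t) / 2 := by ring
  rw [e, Real.log_div (by linarith) (by norm_num), Real.log_div (by linarith) (by norm_num), mgA]
  ring

theorem mgA_ge {t : ℝ} (h0 : 0 ≤ t) (h1 : t < 1) : 2 * t ≤ mgA t := by
  have hd : ∀ x ∈ Set.Ico (0 : ℝ) 1,
      HasDerivAt (fun x => mgA x - 2 * x) (2 / (1 - x ^ 2) - 2 * 1) x := fun x hx =>
    (mgA_deriv (by linarith [hx.1]) hx.2).sub ((hasDerivAt_id x).const_mul 2)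
  have hm : MonotoneOn (fun x => mgA x - 2 * x) (Set.Ico 0 1) := by
    apply monotoneOn_of_deriv_nonneg (convex_Ico 0 1)
    · exact fun x hx => (hd x hx).continuousAt.continuousWithinAt
    · exact fun x hx => (hd x (interior_subset hx)).differentiableAt.differentiableWithinAt
    · intro x hx
      have hx := interior_subset hx
      rw [(hd x hx).deriv]
      have : 0 < 1 - x ^ 2 := by nlinarith [hx.1, hx.2]
      rw [sub_nonneg, le_div_iff₀ this]
      nlinarith [sq_nonneg x]
  have := hm (a := 0) (b := t) (by simp) ⟨h0, h1⟩ h0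
  simp [mgA] at this
  simp only [mgA]; linarith

theorem mgphi_anti : AntitoneOn (fun t => (1 - t ^ 2) * mgA t / t) (Set.Ioo 0 1) := by
  have hd : ∀ x ∈ Set.Ioo (0 : ℝ) 1,
      HasDerivAt (fun t => (1 - t ^ 2) * mgA t / t) ((2 * x - (1 + x ^ 2) * mgA x) / x ^ 2) x := by
    intro x hx
    have a1 : HasDerivAt (fun t : ℝ => 1 - t ^ 2) (-(2 * x)) x := by
      simpa using (hasDerivAt_pow 2 x).const_sub 1
    have := (a1.mul (mgA_deriv (by linarith [hx.1]) hx.2)).div (hasDerivAt_id x) hx.1.ne'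
    refine this.congr_deriv ?_
    have : (1 - x ^ 2) ≠ 0 := by nlinarith [hx.1, hx.2]
    have := hx.1.ne'
    simp only [id, Pi.mul_apply]
    field_simp
    ring
  apply antitoneOn_of_deriv_nonpos (convex_Ioo 0 1)
  · exact fun x hx => (hd x hx).continuousAt.continuousWithinAt
  · exact fun x hx => (hd x (interior_subset hx)).differentiableAt.differentiableWithinAt
  · intro x hx
    have hx := interior_subset hx
    rw [(hd x hx).deriv]
    have := mgA_ge hx.1.le hx.2
    apply div_nonpos_of_nonpos_of_nonneg _ (sq_nonneg x)
    nlinarith [sq_nonneg x, hx.1, mul_nonneg (sq_nonneg x) (by linarith [hx.1] : 0 ≤ mgA x)]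

theorem mgratio_anti {c : ℝ} (hc : 0 < c) (hc1 : c ≤ 1) :
    AntitoneOn (fun t => mgA (c * t) / mgA t) (Set.Ioo 0 1) := by
  have hpos : ∀ x ∈ Set.Ioo (0 : ℝ) 1, 0 < mgA x := fun x hx => by
    linarith [mgA_ge hx.1.le hx.2, hx.1]
  have hcx : ∀ x ∈ Set.Ioo (0 : ℝ) 1, c * x ∈ Set.Ioo (0 : ℝ) 1 ∧ c * x ≤ x := fun x hx =>
    ⟨⟨mul_pos hc hx.1, by nlinarith [hx.1, hx.2]⟩, by nlinarith [hx.1, hx.2]⟩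
  have hd : ∀ x ∈ Set.Ioo (0 : ℝ) 1,
      HasDerivAt (fun t => mgA (c * t) / mgA t)
        ((2 / (1 - (c * x) ^ 2) * (c * 1) * mgA x - mgA (c * x) * (2 / (1 - x ^ 2))) / mgA x ^ 2) x := by
    intro x hx
    obtain ⟨h1, h2⟩ := hcx x hx
    have a1 := HasDerivAt.comp x (mgA_deriv (by linarith [h1.1]) h1.2)
      ((hasDerivAt_id x).const_mul c)
    exact a1.div (mgA_deriv (by linarith [hx.1]) hx.2) (hpos x hx).ne'
  apply antitoneOn_of_deriv_nonpos (convex_Ioo 0 1)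
  · exact fun x hx => (hd x hx).continuousAt.continuousWithinAt
  · exact fun x hx => (hd x (interior_subset hx)).differentiableAt.differentiableWithinAt
  · intro x hx
    have hx := interior_subset hx
    rw [(hd x hx).deriv]
    apply div_nonpos_of_nonpos_of_nonneg _ (sq_nonneg _)
    obtain ⟨h1, h2⟩ := hcx x hx
    have := mgphi_anti h1 hx h2
    simp only at this
    rw [div_le_div_iff₀ hx.1 h1.1] at this
    have p1 : 0 < 1 - x ^ 2 := by nlinarith [hx.1, hx.2]
    have p2 : 0 < 1 - (c * x) ^ 2 := by nlinarith [h1.1, h1.2]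
    have k : (1 - x ^ 2) * mgA x * c ≤ (1 - (c * x) ^ 2) * mgA (c * x) := by
      refine le_of_mul_le_mul_right ?_ hx.1
      linarith
    have e : 2 / (1 - (c * x) ^ 2) * (c * 1) * mgA x - mgA (c * x) * (2 / (1 - x ^ 2))
        = 2 * ((1 - x ^ 2) * mgA x * c - (1 - (c * x) ^ 2) * mgA (c * x)) /
          ((1 - (c * x) ^ 2) * (1 - x ^ 2)) := by
      have := p1.ne'
      have := p2.ne'
      generalize mgA x = u at *
      generalize mgA (c * x) = v at *
      generalize 1 - x ^ 2 = r at *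
      generalize 1 - (c * x) ^ 2 = s at *
      field_simp
    rw [e]
    apply div_nonpos_of_nonpos_of_nonneg _ (mul_pos p2 p1).le
    linarith

theorem mgE_cont : Continuous mgE := by
  unfold mgE
  fun_prop

theorem mgE_neg (t : ℝ) : mgE (-t) = mgE t := by
  unfold mgE
  rw [← Real.binEntropy_one_sub]
  congr 1
  ring

/-- supporting line -/
theorem mg_support {c s : ℝ} (hc : 0 ≤ c) (hc1 : c ≤ 1) (hs : s ∈ Set.Ioo (0 : ℝ) 1) :
    ∃ l : ℝ, ∀ t ∈ Set.Icc (-1 : ℝ) 1, mgE (c * s) - l * mgE s ≤ mgE (c * t) - l * mgE t := by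
  rcases hc.eq_or_lt with rfl | hc
  · exact ⟨0, by simp⟩
  have hpos : ∀ x ∈ Set.Ioo (0 : ℝ) 1, 0 < mgA x := fun x hx => by
    linarith [mgA_ge hx.1.le hx.2, hx.1]
  set l := c * (mgA (c * s) / mgA s) with hl
  refine ⟨l, ?_⟩
  have hd : ∀ x ∈ Set.Ioo (0 : ℝ) 1, HasDerivAt (fun t => mgE (c * t) - l * mgE t)
      (c / 2 * mgA x * (mgA (c * s) / mgA s - mgA (c * x) / mgA x)) x := by
    intro x hx
    have h1 : 0 < c * x := mul_pos hc hx.1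
    have h2 : c * x < 1 := by nlinarith [hx.1, hx.2]
    have a1 := HasDerivAt.comp x (mgE_deriv (by linarith) h2) ((hasDerivAt_id x).const_mul c)
    have := a1.sub ((mgE_deriv (by linarith [hx.1]) hx.2).const_mul l)
    refine this.congr_deriv ?_
    have := (hpos x hx).ne'
    have := (hpos s hs).ne'
    rw [hl]
    field_simp
    ring
  have hcont : Continuous (fun t => mgE (c * t) - l * mgE t) := by
    have := mgE_cont
    fun_prop
  have hanti : AntitoneOn (fun t => mgE (c * t) - l * mgE t) (Set.Icc 0 s) := by
    apply antitoneOn_of_deriv_nonpos (convex_Icc 0 s) hcont.continuousOn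
    · intro x hx
      rw [interior_Icc] at hx
      exact (hd x ⟨hx.1, hx.2.trans hs.2⟩).differentiableAt.differentiableWithinAt
    · intro x hx
      rw [interior_Icc] at hx
      have hx' : x ∈ Set.Ioo (0 : ℝ) 1 := ⟨hx.1, hx.2.trans hs.2⟩
      rw [(hd x hx').deriv]
      have := mgratio_anti hc hc1 hx' hs hx.2.le
      simp only at this
      have h3 := hpos x hx'
      exact mul_nonpos_of_nonneg_of_nonpos (by positivity) (by linarith)
  have hmono : MonotoneOn (fun t => mgE (c * t) - l * mgE t) (Set.Icc s 1) := by
    apply monotoneOn_of_deriv_nonneg (convex_Icc s 1) hcont.continuousOn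
    · intro x hx
      rw [interior_Icc] at hx
      exact (hd x ⟨hs.1.trans hx.1, hx.2⟩).differentiableAt.differentiableWithinAt
    · intro x hx
      rw [interior_Icc] at hx
      have hx' : x ∈ Set.Ioo (0 : ℝ) 1 := ⟨hs.1.trans hx.1, hx.2⟩
      rw [(hd x hx').deriv]
      have := mgratio_anti hc hc1 hs hx' hx.1.le
      simp only at this
      have h3 := hpos x hx'
      exact mul_nonneg (by positivity) (by linarith)
  have main : ∀ t ∈ Set.Icc (0 : ℝ) 1,
      mgE (c * s) - l * mgE s ≤ mgE (c * t) - l * mgE t := by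
    intro t ht
    rcases le_total t s with h | h
    · exact hanti ⟨ht.1, h⟩ ⟨hs.1.le, le_rfl⟩ h
    · exact hmono ⟨le_rfl, hs.2.le⟩ ⟨h, ht.2⟩ h
  intro t ht
  rcases le_total 0 t with h | h
  · exact main t ⟨h, ht.2⟩
  · have := main (-t) ⟨by linarith, by linarith [ht.1]⟩
    rwa [mul_neg, mgE_neg, mgE_neg] at this

theorem mg_h2 (p : ℝ) : h2 p = mgE (1 - 2 * p) / Real.log 2 := by
  have : (1 - (1 - 2 * p)) / 2 = p := by ring
  rw [mgE, this, Real.binEntropy, h2, Real.logb, Real.logb, Real.log_inv, Real.log_inv]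
  ring

theorem mg_main {Y : Type*} [Fintype Y]
    (P : Y → ℝ) (hP : ∀ y, 0 ≤ P y) (hPsum : ∑ y, P y = 1)
    (t : Y → ℝ) (ht : ∀ y, t y ∈ Set.Icc (-1 : ℝ) 1)
    (s c : ℝ) (hs : s ∈ Set.Icc (0 : ℝ) 1) (hc : c ∈ Set.Icc (0 : ℝ) 1)
    (hEq : mgE s = ∑ y, P y * mgE (t y)) :
    mgE (c * s) ≤ ∑ y, P y * mgE (c * t y) := by
  have hconst : ∀ K : ℝ, ∑ y, P y * K = K := fun K => by rw [← Finset.sum_mul, hPsum, one_mul]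
  rcases hs.1.eq_or_lt with rfl | h0
  · have hE0 : mgE 0 = Real.log 2 := by simp [mgE]
    have hz : ∑ y, P y * (Real.log 2 - mgE (t y)) = 0 := by
      simp only [mul_sub, Finset.sum_sub_distrib]
      rw [hconst, ← hEq, hE0, sub_self]
    have hle : ∀ y, mgE (t y) ≤ Real.log 2 := fun y => Real.binEntropy_le_log_two
    rw [Finset.sum_eq_zero_iff_of_nonneg (fun y _ => mul_nonneg (hP y)
      (sub_nonneg.2 (hle y)))] at hz
    rw [← hconst (mgE (c * 0))]
    refine Finset.sum_le_sum fun y _ => ?_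
    rcases mul_eq_zero.1 (hz y (Finset.mem_univ y)) with h | h
    · simp [h]
    · have : (1 - t y) / 2 = 2⁻¹ := Real.binEntropy_eq_log_two.1 (by
        simp only [mgE] at h; linarith)
      have : t y = 0 := by linarith
      rw [this]
  rcases hs.2.eq_or_lt with rfl | h1
  · have hE0 : mgE 1 = 0 := by simp [mgE]
    rw [hE0] at hEq
    have hz := hEq.symm
    have hge : ∀ y, 0 ≤ mgE (t y) := fun y =>
      Real.binEntropy_nonneg (by linarith [(ht y).2]) (by linarith [(ht y).1])
    rw [Finset.sum_eq_zero_iff_of_nonneg (fun y _ => mul_nonneg (hP y) (hge y))] at hz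
    rw [← hconst (mgE (c * 1))]
    refine Finset.sum_le_sum fun y _ => ?_
    rcases mul_eq_zero.1 (hz y (Finset.mem_univ y)) with h | h
    · simp [h]
    · rcases Real.binEntropy_eq_zero.1 h with h | h
      · have : t y = 1 := by linarith
        rw [this]
      · have : t y = -1 := by linarith
        rw [this, mul_neg, mgE_neg]
  obtain ⟨l, hl⟩ := mg_support hc.1 hc.2 ⟨h0, h1⟩
  have := Finset.sum_le_sum fun y (_ : y ∈ Finset.univ) =>
    mul_le_mul_of_nonneg_left (hl (t y) (ht y)) (hP y)
  rw [hconst] at this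
  have e : ∑ y, P y * (mgE (c * t y) - l * mgE (t y))
      = ∑ y, P y * mgE (c * t y) - l * mgE s := by
    rw [hEq, Finset.mul_sum, ← Finset.sum_sub_distrib]
    exact Finset.sum_congr rfl fun y _ => by ring
  rw [e] at this
  linarith

theorem mrs_gerber_averaged {Y : Type*} [Fintype Y]
    (P : Y → ℝ) (hP : ∀ y, 0 ≤ P y) (hPsum : ∑ y, P y = 1)
    (q : Y → ℝ) (hq : ∀ y, q y ∈ Set.Icc (0 : ℝ) 1)
    (a b : ℝ) (ha : a ∈ Set.Icc (0 : ℝ) (1 / 2)) (hb : b ∈ Set.Icc (0 : ℝ) (1 / 2))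
    (hEq : h2 a = ∑ y, P y * h2 (q y)) :
    ∑ y, P y * h2 (bconv (q y) b) ≥ h2 (bconv a b) := by
  have hlog : 0 < Real.log 2 := Real.log_pos (by norm_num)
  have hcv : ∀ x, 1 - 2 * bconv x b = (1 - 2 * b) * (1 - 2 * x) := fun x => by
    unfold bconv; ring
  simp only [mg_h2, hcv, ← mul_div_assoc, ← Finset.sum_div] at hEq ⊢
  rw [div_left_inj' hlog.ne'] at hEq
  rw [ge_iff_le, div_le_div_iff_of_pos_right hlog]
  exact mg_main P hP hPsum (fun y => 1 - 2 * q y)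
    (fun y => ⟨by linarith [(hq y).2], by linarith [(hq y).1]⟩) _ _
    ⟨by linarith [ha.2], by linarith [ha.1]⟩ ⟨by linarith [hb.2], by linarith [hb.1]⟩ hEq
end

section
/- Let Y₁ and Y₂ be finite types, let P₁ : Y₁ → ℝ and P₂ : Y₂ → ℝ be probability mass functions, let q₁ : Y₁ → [0,1] and q₂ : Y₂ → [0,1], and let a ∈ [0,1/2] be such that h₂(a) = ∑_{y₁} P₁(y₁)·h₂(q₁(y₁)) = ∑_{y₂} P₂(y₂)·h₂(q₂(y₂)). Then ∑_{y₁} ∑_{y₂} P₁(y₁)·P₂(y₂)·h₂(q₁(y₁)⋆q₂(y₂)) ≥ h₂(a⋆a). -/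
namespace MrsG

noncomputable def L (t : ℝ) : ℝ := Real.log (1 + t) - Real.log (1 - t)

noncomputable def G (t : ℝ) : ℝ := Real.binEntropy ((1 - t) / 2)

lemma L_hasDeriv {t : ℝ} (h0 : -1 < t) (h1 : t < 1) : HasDerivAt L (2 / (1 - t ^ 2)) t := by
  have a1 : (1 + t) ≠ 0 := by linarith
  have a2 : (1 - t) ≠ 0 := by linarith
  have a3 : (1 - t ^ 2) ≠ 0 := by
    have : 1 - t ^ 2 = (1 + t) * (1 - t) := by ring
    rw [this]; exact mul_ne_zero a1 a2
  have e1 := ((hasDerivAt_id t).const_add 1).log a1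
  have e2 := ((hasDerivAt_id t).const_sub 1).log a2
  refine (e1.sub e2).congr_deriv ?_
  simp only [id]
  have : 1 - t ^ 2 = (1 + t) * (1 - t) := by ring
  rw [this]
  field_simp
  ring

lemma L_zero : L 0 = 0 := by simp [L]

lemma L_ge {t : ℝ} (h0 : 0 ≤ t) (h1 : t < 1) : 2 * t ≤ L t := by
  have hm : MonotoneOn (fun t => L t - 2 * t) (Set.Ico 0 1) := by
    have hd : ∀ x ∈ Set.Ico (0:ℝ) 1,
        HasDerivAt (fun t => L t - 2 * t) (2 / (1 - x ^ 2) - 2 * 1) x := by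
      intro x hx
      exact (L_hasDeriv (by linarith [hx.1]) hx.2).sub ((hasDerivAt_id x).const_mul 2)
    apply monotoneOn_of_deriv_nonneg (convex_Ico 0 1)
    · exact fun x hx => (hd x hx).continuousAt.continuousWithinAt
    · exact fun x hx => (hd x (interior_subset hx)).differentiableAt.differentiableWithinAt
    · intro x hx
      have hx' := interior_subset hx
      rw [(hd x hx').deriv]
      have : 0 < 1 - x ^ 2 := by nlinarith [hx'.1, hx'.2]
      rw [sub_nonneg, le_div_iff₀ this]
      nlinarith [sq_nonneg x]
  have := hm (show (0:ℝ) ∈ Set.Ico (0:ℝ) 1 by simp) ⟨h0, h1⟩ h0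
  simp [L_zero] at this
  linarith

lemma M_anti : AntitoneOn (fun t => (1 - t ^ 2) * L t / t) (Set.Ioo 0 1) := by
  have hd : ∀ x ∈ Set.Ioo (0:ℝ) 1, HasDerivAt (fun t => (1 - t ^ 2) * L t / t)
      ((2 * x - (1 + x ^ 2) * L x) / x ^ 2) x := by
    intro x hx
    have h0 := hx.1
    have : 0 < 1 - x ^ 2 := by nlinarith [hx.1, hx.2]
    have e := ((((hasDerivAt_id x).pow 2).const_sub 1).mul
      (L_hasDeriv (by linarith) hx.2)).div (hasDerivAt_id x) h0.ne'
    refine e.congr_deriv ?_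
    simp
    field_simp
    ring
  apply antitoneOn_of_deriv_nonpos (convex_Ioo 0 1)
  · exact fun x hx => (hd x hx).continuousAt.continuousWithinAt
  · exact fun x hx => (hd x (interior_subset hx)).differentiableAt.differentiableWithinAt
  · intro x hx
    have hx' := interior_subset hx
    rw [(hd x hx').deriv]
    have := L_ge hx'.1.le hx'.2
    apply div_nonpos_of_nonpos_of_nonneg _ (sq_nonneg x)
    nlinarith [hx'.1, sq_nonneg x, mul_nonneg (sq_nonneg x) (by linarith [hx'.1] : 0 ≤ L x)]

lemma R_anti {c : ℝ} (c0 : 0 < c) (c1 : c ≤ 1) :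
    AntitoneOn (fun t => L (c * t) / L t) (Set.Ioo 0 1) := by
  have hLp : ∀ x ∈ Set.Ioo (0:ℝ) 1, 0 < L x := fun x hx => by
    linarith [L_ge hx.1.le hx.2, hx.1]
  have hcx : ∀ x ∈ Set.Ioo (0:ℝ) 1, c * x ∈ Set.Ioo (0:ℝ) 1 := fun x hx =>
    ⟨mul_pos c0 hx.1, by nlinarith [hx.1, hx.2]⟩
  have hd : ∀ x ∈ Set.Ioo (0:ℝ) 1, HasDerivAt (fun t => L (c * t) / L t)
      (((2 / (1 - (c * x) ^ 2) * c) * L x - L (c * x) * (2 / (1 - x ^ 2))) / L x ^ 2) x := by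
    intro x hx
    have h2 := hcx x hx
    have hi : HasDerivAt (fun t => c * t) c x := by
      simpa using (hasDerivAt_id x).const_mul c
    have e1 : HasDerivAt (fun t => L (c * t)) _ x :=
      HasDerivAt.comp x (L_hasDeriv (by linarith [h2.1]) h2.2) hi
    exact e1.div (L_hasDeriv (by linarith [hx.1]) hx.2) (hLp x hx).ne'
  apply antitoneOn_of_deriv_nonpos (convex_Ioo 0 1)
  · exact fun x hx => (hd x hx).continuousAt.continuousWithinAt
  · exact fun x hx => (hd x (interior_subset hx)).differentiableAt.differentiableWithinAt
  · intro x hx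
    have hx' := interior_subset hx
    have h2 := hcx x hx'
    rw [(hd x hx').deriv]
    apply div_nonpos_of_nonpos_of_nonneg _ (sq_nonneg _)
    have hM := M_anti h2 hx' (by nlinarith [hx'.1])
    simp only at hM
    have hx0 := hx'.1
    rw [div_le_div_iff₀ hx'.1 h2.1] at hM
    have hM' : (1 - x ^ 2) * L x * c ≤ (1 - (c * x) ^ 2) * L (c * x) := by
      refine le_of_mul_le_mul_right ?_ hx0
      linarith
    have p1 : 0 < 1 - x ^ 2 := by nlinarith [hx'.1, hx'.2]
    have p2 : 0 < 1 - (c * x) ^ 2 := by nlinarith [h2.1, h2.2]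
    have : 2 / (1 - (c * x) ^ 2) * c * L x - L (c * x) * (2 / (1 - x ^ 2))
      = 2 * ((1 - x ^ 2) * L x * c - (1 - (c * x) ^ 2) * L (c * x)) /
        ((1 - (c * x) ^ 2) * (1 - x ^ 2)) := by
      clear hM hM' hd
      generalize c * x = w at *
      field_simp
    rw [this]
    apply div_nonpos_of_nonpos_of_nonneg _ (by positivity)
    linarith

lemma G_anti : AntitoneOn G (Set.Icc 0 1) := by
  intro x hx y hy hxy
  apply Real.binEntropy_strictMonoOn.monotoneOn
  · constructor <;> linarith [hy.1, hy.2]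
  · constructor <;> linarith [hx.1, hx.2]
  · linarith

lemma G_neg (t : ℝ) : G (-t) = G t := by
  unfold G
  rw [← Real.binEntropy_one_sub]
  congr 1; ring

lemma G_abs (t : ℝ) : G |t| = G t := by
  rcases abs_choice t with h | h <;> rw [h]
  exact G_neg t

lemma G_cont : Continuous G := by unfold G; fun_prop

lemma G_hasDeriv {t : ℝ} (h0 : -1 < t) (h1 : t < 1) : HasDerivAt G (-(L t) / 2) t := by
  have e := Real.hasDerivAt_binEntropy (p := (1 - t) / 2) (by linarith) (by linarith)
  have e2 : HasDerivAt (fun t : ℝ => (1 - t) / 2) (-1 / 2) t :=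
    ((hasDerivAt_id t).const_sub 1).div_const 2
  refine (HasDerivAt.comp t e e2).congr_deriv ?_
  have : 1 - (1 - t) / 2 = (1 + t) / 2 := by ring
  rw [this, Real.log_div (by linarith) (by norm_num), Real.log_div (by linarith) (by norm_num)]
  unfold L
  ring

lemma key {c s : ℝ} (c0 : 0 ≤ c) (c1 : c ≤ 1) (s0 : 0 ≤ s) (s1 : s ≤ 1) :
    ∃ l : ℝ, ∀ t ∈ Set.Icc (0:ℝ) 1, l * (G t - G s) ≤ G (c * t) - G (c * s) := by
  rcases c0.eq_or_lt with rfl | c0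
  · exact ⟨0, by simp⟩
  rcases s0.eq_or_lt with rfl | s0
  · refine ⟨1, fun t ht => ?_⟩
    have := G_anti (a := c * t) (b := t) ⟨by nlinarith [ht.1], by nlinarith [ht.1, ht.2]⟩ ht
      (by nlinarith [ht.1])
    simp; linarith
  rcases s1.eq_or_lt with rfl | s1
  · refine ⟨0, fun t ht => ?_⟩
    have := G_anti (a := c * t) (b := c * 1) ⟨by nlinarith [ht.1], by nlinarith [ht.1, ht.2]⟩
      ⟨by linarith, by linarith⟩ (by nlinarith [ht.2])
    linarith
  have hLp : ∀ x ∈ Set.Ioo (0:ℝ) 1, 0 < L x := fun x hx => by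
    linarith [L_ge hx.1.le hx.2, hx.1]
  have hs := hLp s ⟨s0, s1⟩
  set r := L (c * s) / L s with hr
  have hd : ∀ x ∈ Set.Ioo (0:ℝ) 1, HasDerivAt (fun t => G (c * t) - c * r * G t)
      (-(L (c * x)) / 2 * c - c * r * (-(L x) / 2)) x := by
    intro x hx
    have hi : HasDerivAt (fun t => c * t) c x := by
      simpa using (hasDerivAt_id x).const_mul c
    have hg : HasDerivAt G (-(L (c * x)) / 2) (c * x) :=
      G_hasDeriv (by nlinarith [mul_pos c0 hx.1]) (by nlinarith [hx.1, hx.2])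
    have e1 : HasDerivAt (fun t => G (c * t)) (-(L (c * x)) / 2 * c) x :=
      HasDerivAt.comp (h₂ := G) x hg hi
    exact e1.sub ((G_hasDeriv (by linarith [hx.1]) hx.2).const_mul _)
  have hcont : Continuous (fun t => G (c * t) - c * r * G t) := by
    have := G_cont; fun_prop
  have hder : ∀ x ∈ Set.Ioo (0:ℝ) 1, deriv (fun t => G (c * t) - c * r * G t) x
      = c * L x / 2 * (r - L (c * x) / L x) := by
    intro x hx
    rw [(hd x hx).deriv]
    have := (hLp x hx).ne'
    field_simp
    ring
  have hR := R_anti c0 c1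
  refine ⟨c * r, fun t ht => ?_⟩
  suffices h : G (c * s) - c * r * G s ≤ G (c * t) - c * r * G t by linarith
  rcases le_total t s with hts | hts
  · have hm : AntitoneOn (fun t => G (c * t) - c * r * G t) (Set.Icc 0 s) := by
      apply antitoneOn_of_deriv_nonpos (convex_Icc 0 s) hcont.continuousOn
      · rw [interior_Icc]
        exact fun x hx => (hd x ⟨hx.1, hx.2.trans s1⟩).differentiableAt.differentiableWithinAt
      · rw [interior_Icc]
        intro x hx
        have hx' : x ∈ Set.Ioo (0:ℝ) 1 := ⟨hx.1, hx.2.trans s1⟩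
        rw [hder x hx']
        have := hR hx' ⟨s0, s1⟩ hx.2.le
        simp only at this
        have := hLp x hx'
        apply mul_nonpos_of_nonneg_of_nonpos (by positivity)
        linarith
    exact hm ⟨ht.1, hts⟩ ⟨s0.le, le_rfl⟩ hts
  · have hm : MonotoneOn (fun t => G (c * t) - c * r * G t) (Set.Icc s 1) := by
      apply monotoneOn_of_deriv_nonneg (convex_Icc s 1) hcont.continuousOn
      · rw [interior_Icc]
        exact fun x hx => (hd x ⟨s0.trans hx.1, hx.2⟩).differentiableAt.differentiableWithinAt
      · rw [interior_Icc]
        intro x hx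
        have hx' : x ∈ Set.Ioo (0:ℝ) 1 := ⟨s0.trans hx.1, hx.2⟩
        rw [hder x hx']
        have := hR ⟨s0, s1⟩ hx' hx.1.le
        simp only at this
        have := hLp x hx'
        apply mul_nonneg (by positivity)
        linarith
    exact hm ⟨le_rfl, s1.le⟩ ⟨hts, ht.2⟩ hts

lemma h2_eq (p : ℝ) : h2 p = G (1 - 2 * p) / Real.log 2 := by
  unfold h2 G Real.binEntropy Real.logb
  have : (1 - (1 - 2 * p)) / 2 = p := by ring
  rw [this, Real.log_inv, Real.log_inv]
  ring

lemma key2 {a b : ℝ} (ha : a ∈ Set.Icc (0:ℝ) (1/2)) (hb : b ∈ Set.Icc (0:ℝ) 1) :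
    ∃ l : ℝ, ∀ x ∈ Set.Icc (0:ℝ) 1, l * (h2 x - h2 a) ≤ h2 (bconv x b) - h2 (bconv a b) := by
  obtain ⟨l, hl⟩ := key (c := |1 - 2 * b|) (s := 1 - 2 * a) (abs_nonneg _)
    (abs_le.2 ⟨by linarith [hb.2], by linarith [hb.1]⟩) (by linarith [ha.2]) (by linarith [ha.1])
  refine ⟨l, fun x hx => ?_⟩
  have h := hl |1 - 2 * x| ⟨abs_nonneg _, abs_le.2 ⟨by linarith [hx.2], by linarith [hx.1]⟩⟩
  have e : ∀ y, 1 - 2 * bconv y b = (1 - 2 * b) * (1 - 2 * y) := by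
    intro y; unfold bconv; ring
  have e2 : G (|1 - 2 * b| * (1 - 2 * a)) = G ((1 - 2 * b) * (1 - 2 * a)) := by
    rw [← G_abs ((1 - 2 * b) * (1 - 2 * a)), abs_mul, abs_of_nonneg (a := 1 - 2 * a)]
    linarith [ha.2]
  rw [← abs_mul, G_abs, G_abs, e2] at h
  rw [h2_eq, h2_eq, h2_eq, h2_eq, e, e, ← sub_div, ← sub_div, ← mul_div_assoc]
  exact div_le_div_of_nonneg_right h (Real.log_nonneg (by norm_num))

lemma avg {Y : Type*} [Fintype Y] (P : Y → ℝ) (hP : ∀ y, 0 ≤ P y) (hs : ∑ y, P y = 1)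
    (q : Y → ℝ) (hq : ∀ y, q y ∈ Set.Icc (0 : ℝ) 1)
    {a b : ℝ} (ha : a ∈ Set.Icc (0:ℝ) (1/2)) (hb : b ∈ Set.Icc (0:ℝ) 1)
    (hE : h2 a = ∑ y, P y * h2 (q y)) :
    h2 (bconv a b) ≤ ∑ y, P y * h2 (bconv (q y) b) := by
  obtain ⟨l, hl⟩ := key2 ha hb
  have h := Finset.sum_le_sum (s := Finset.univ) fun y _ =>
    mul_le_mul_of_nonneg_left (hl (q y) (hq y)) (hP y)
  have e1 : ∑ y, P y * (l * (h2 (q y) - h2 a)) = l * (∑ y, P y * h2 (q y) - (∑ y, P y) * h2 a) := by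
    rw [Finset.sum_mul, ← Finset.sum_sub_distrib, Finset.mul_sum]
    exact Finset.sum_congr rfl fun y _ => by ring
  have e2 : ∑ y, P y * (h2 (bconv (q y) b) - h2 (bconv a b))
      = ∑ y, P y * h2 (bconv (q y) b) - (∑ y, P y) * h2 (bconv a b) := by
    rw [Finset.sum_mul, ← Finset.sum_sub_distrib]
    exact Finset.sum_congr rfl fun y _ => by ring
  rw [e1, e2, hs, ← hE] at h
  linarith

lemma bconv_symm (a b : ℝ) : bconv a b = bconv b a := by unfold bconv; ring

end MrsG

theorem mrs_gerber_two_channels {Y₁ Y₂ : Type*} [Fintype Y₁] [Fintype Y₂]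
    (P₁ : Y₁ → ℝ) (hP₁ : ∀ y, 0 ≤ P₁ y) (hP₁sum : ∑ y, P₁ y = 1)
    (P₂ : Y₂ → ℝ) (hP₂ : ∀ y, 0 ≤ P₂ y) (hP₂sum : ∑ y, P₂ y = 1)
    (q₁ : Y₁ → ℝ) (hq₁ : ∀ y, q₁ y ∈ Set.Icc (0 : ℝ) 1)
    (q₂ : Y₂ → ℝ) (hq₂ : ∀ y, q₂ y ∈ Set.Icc (0 : ℝ) 1)
    (a : ℝ) (ha : a ∈ Set.Icc (0 : ℝ) (1 / 2))
    (hEq₁ : h2 a = ∑ y, P₁ y * h2 (q₁ y))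
    (hEq₂ : h2 a = ∑ y, P₂ y * h2 (q₂ y)) :
    ∑ y₁, ∑ y₂, P₁ y₁ * P₂ y₂ * h2 (bconv (q₁ y₁) (q₂ y₂)) ≥ h2 (bconv a a) := by
  have ha' : a ∈ Set.Icc (0:ℝ) 1 := ⟨ha.1, by linarith [ha.2]⟩
  calc h2 (bconv a a) ≤ ∑ y₂, P₂ y₂ * h2 (bconv (q₂ y₂) a) :=
        MrsG.avg P₂ hP₂ hP₂sum q₂ hq₂ ha ha' hEq₂
    _ ≤ ∑ y₂, P₂ y₂ * ∑ y₁, P₁ y₁ * h2 (bconv (q₁ y₁) (q₂ y₂)) := by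
        apply Finset.sum_le_sum
        intro y _
        rw [MrsG.bconv_symm (q₂ y) a]
        exact mul_le_mul_of_nonneg_left
          (MrsG.avg P₁ hP₁ hP₁sum q₁ hq₁ ha (hq₂ y) hEq₁) (hP₂ y)
    _ = ∑ y₁, ∑ y₂, P₁ y₁ * P₂ y₂ * h2 (bconv (q₁ y₁) (q₂ y₂)) := by
        rw [Finset.sum_comm]
        refine Finset.sum_congr rfl fun y _ => ?_
        rw [Finset.mul_sum]
        exact Finset.sum_congr rfl fun z _ => by ring
end

section
/- Let Y₁ and Y₂ be finite types, let P₁ : Y₁ → ℝ and P₂ : Y₂ → ℝ be probability mass functions, let q₁ : Y₁ → [0,1] and q₂ : Y₂ → [0,1], and let a ∈ [0,1/2] be such that H₀ := h₂(a) = ∑_{y₁} P₁(y₁)·h₂(q₁(y₁)) = ∑_{y₂} P₂(y₂)·h₂(q₂(y₂)). Then ∑_{y₁} ∑_{y₂} P₁(y₁)·P₂(y₂)·h₂(q₁(y₁)⋆q₂(y₂)) ≥ H₀ + H₀²·(1 − H₀). -/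
open Real in
lemma aux_h2_eq (p : ℝ) : h2 p = binEntropy p / log 2 := by
  simp only [h2, binEntropy, Real.logb, log_inv]
  ring

open Real in
lemma aux_series (t : ℝ) (ht : |t| < 1) :
    HasSum (fun n : ℕ => (1 / ((2 * (n : ℝ) + 1) * (2 * n + 2))) * (t ^ 2) ^ (n + 1))
      (log 2 - binEntropy ((1 - t) / 2)) := by
  have ht2 : |t ^ 2| < 1 := by
    rw [abs_pow]; exact pow_lt_one₀ (abs_nonneg _) ht (by norm_num)
  have h1 := hasSum_pow_div_log_of_abs_lt_one ht2
  have h2 := (hasSum_log_sub_log_of_abs_lt_one ht).mul_left t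
  have h3 := (h2.sub h1).mul_left (1 / 2)
  obtain ⟨ha, hb⟩ := abs_lt.1 ht
  have e1 : (1 - t) ≠ 0 := by linarith
  have e2 : (1 + t) ≠ 0 := by linarith
  have hval : log 2 - binEntropy ((1 - t) / 2)
      = 1 / 2 * (t * (log (1 + t) - log (1 - t)) - -log (1 - t ^ 2)) := by
    have f1 : 1 - t ^ 2 = (1 - t) * (1 + t) := by ring
    have f2 : 1 - (1 - t) / 2 = (1 + t) / 2 := by ring
    rw [f1, log_mul e1 e2, binEntropy, f2, log_inv, log_inv, log_div e1 two_ne_zero,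
      log_div e2 two_ne_zero]
    ring
  rw [hval]
  refine Eq.mp (congrArg (fun f => HasSum f _) (funext fun n => Eq.symm ?_)) h3
  have : (2 * (n : ℝ) + 1) ≠ 0 := by positivity
  have : ((n : ℝ) + 1) ≠ 0 := by positivity
  have : (2 * (n : ℝ) + 2) ≠ 0 := by positivity
  have e : t * (2 * (1 / (2 * (n : ℝ) + 1)) * t ^ (2 * n + 1))
      = 2 * (1 / (2 * (n : ℝ) + 1)) * (t ^ 2) ^ (n + 1) := by
    rw [← pow_mul]; ring
  rw [e]
  field_simp
  ring

open Real in
lemma aux_contr_lt (s t : ℝ) (hs : |s| < 1) (ht : |t| ≤ 1) :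
    log 2 - binEntropy ((1 - t * s) / 2) ≤ t ^ 2 * (log 2 - binEntropy ((1 - s) / 2)) := by
  have hts : |t * s| < 1 := by
    rw [abs_mul]
    calc |t| * |s| ≤ 1 * |s| := by gcongr
      _ < 1 := by simpa using hs
  have ht2 : t ^ 2 ≤ 1 := by rwa [sq_le_one_iff_abs_le_one]
  refine hasSum_le (fun n => ?_) (aux_series _ hts) ((aux_series s hs).mul_left (t ^ 2))
  have h : (t ^ 2) ^ (n + 1) ≤ t ^ 2 := by
    calc (t ^ 2) ^ (n + 1) ≤ (t ^ 2) ^ 1 :=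
          pow_le_pow_of_le_one (sq_nonneg t) ht2 (by omega)
      _ = t ^ 2 := by ring
  rw [mul_pow, mul_pow]
  have h0 : 0 ≤ 1 / ((2 * (n : ℝ) + 1) * (2 * n + 2)) * (s ^ 2) ^ (n + 1) := by positivity
  nlinarith [mul_le_mul_of_nonneg_right h h0]

open Real in
lemma aux_contr (s t : ℝ) (hs : |s| ≤ 1) (ht : |t| ≤ 1) :
    log 2 - binEntropy ((1 - t * s) / 2) ≤ t ^ 2 * (log 2 - binEntropy ((1 - s) / 2)) := by
  have key : ∀ r ∈ closure (Set.Ico (0 : ℝ) 1),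
      log 2 - binEntropy ((1 - t * (s * r)) / 2)
        ≤ t ^ 2 * (log 2 - binEntropy ((1 - s * r) / 2)) := by
    intro r hr
    refine le_on_closure (s := Set.Ico (0 : ℝ) 1)
      (f := fun r => log 2 - binEntropy ((1 - t * (s * r)) / 2))
      (g := fun r => t ^ 2 * (log 2 - binEntropy ((1 - s * r) / 2))) ?_ ?_ ?_ hr
    · intro x hx
      apply aux_contr_lt _ _ _ ht
      rw [abs_mul, abs_of_nonneg hx.1]
      calc |s| * x ≤ 1 * x := mul_le_mul_of_nonneg_right hs hx.1
        _ < 1 := by simpa using hx.2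
    · exact Continuous.continuousOn (by fun_prop)
    · exact Continuous.continuousOn (by fun_prop)
  have := key 1 (by rw [closure_Ico (by norm_num)]; simp)
  simpa using this

open Real in
lemma aux_deriv1 (p : ℝ) (h0 : 0 < p) (h1 : p < 1) :
    HasDerivAt (fun p => 2 * log 2 * √(p * (1 - p)) - binEntropy p)
      (log 2 * ((1 - 2 * p) / √(p * (1 - p))) - (log (1 - p) - log p)) p := by
  have hp : 0 < p * (1 - p) := mul_pos h0 (by linarith)
  have hq : HasDerivAt (fun p : ℝ => p * (1 - p)) (1 - 2 * p) p := by
    exact ((hasDerivAt_id' p).mul ((hasDerivAt_id' p).const_sub 1)).congr_deriv (by ring)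
  refine (((hq.sqrt hp.ne').const_mul (2 * log 2)).sub
    (hasDerivAt_binEntropy h0.ne' h1.ne)).congr_deriv ?_
  ring

open Real in
lemma aux_deriv2 (p : ℝ) (h0 : 0 < p) (h1 : p < 1) :
    HasDerivAt (fun p => log 2 * ((1 - 2 * p) / √(p * (1 - p))) - (log (1 - p) - log p))
      ((2 * √(p * (1 - p)) - log 2) / (2 * √(p * (1 - p)) ^ 3)) p := by
  have h1' : 0 < 1 - p := by linarith
  have hp : 0 < p * (1 - p) := mul_pos h0 h1'
  have hr : 0 < √(p * (1 - p)) := Real.sqrt_pos.2 hp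
  have hq : HasDerivAt (fun p : ℝ => p * (1 - p)) (1 - 2 * p) p := by
    exact ((hasDerivAt_id' p).mul ((hasDerivAt_id' p).const_sub 1)).congr_deriv (by ring)
  have hn : HasDerivAt (fun p : ℝ => 1 - 2 * p) (-2) p := by
    exact (((hasDerivAt_id' p).const_mul 2).const_sub 1).congr_deriv (by ring)
  have hl : HasDerivAt (fun p : ℝ => log (1 - p)) (-1 / (1 - p)) p := by
    exact ((hasDerivAt_id' p).const_sub 1).log h1'.ne'
  refine (((hn.div (hq.sqrt hp.ne') hr.ne').const_mul (log 2)).sub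
    (hl.sub (hasDerivAt_log h0.ne'))).congr_deriv ?_
  have hsq : √(p * (1 - p)) ^ 2 = p * (1 - p) := Real.sq_sqrt hp.le
  have e : -1 / (1 - p) - p⁻¹ = - (1 / √(p * (1 - p)) ^ 2) := by
    rw [hsq]; field_simp; ring
  rw [e]
  generalize √(p * (1 - p)) = r at *
  field_simp
  linear_combination (-4 * log 2) * hsq

open Real in
lemma aux_ent_le (p : ℝ) (hp0 : 0 ≤ p) (hp1 : p ≤ 1 / 2) :
    binEntropy p ≤ 2 * log 2 * √(p * (1 - p)) := by
  have hL0 : 0 < log 2 := log_pos (by norm_num)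
  have hL1 : log 2 < 1 := by have := log_two_lt_d9; linarith
  set L := log 2 with hL
  set τ := √(1 - L ^ 2) with hτ
  have hτ0 : 0 ≤ τ := Real.sqrt_nonneg _
  have hτ2 : τ ^ 2 = 1 - L ^ 2 := Real.sq_sqrt (by nlinarith)
  have hτ1 : τ < 1 := by nlinarith
  set G : ℝ → ℝ := fun p => 2 * L * √(p * (1 - p)) - binEntropy p with hG
  have hGc : Continuous G := by
    simp only [hG]; fun_prop
  have hhalf : G (1 / 2) = 0 := by
    have : √((1 / 2 : ℝ) * (1 - 1 / 2)) = 1 / 2 := by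
      rw [show (1 / 2 : ℝ) * (1 - 1 / 2) = (1 / 2) ^ 2 by norm_num]
      exact Real.sqrt_sq (by norm_num)
    simp only [hG, this]
    rw [one_div, binEntropy_two_inv]; ring
  have hzero : G 0 = 0 := by simp [hG]
  have hsymm : ∀ x, G (1 - x) = G x := by
    intro x
    simp only [hG, binEntropy_one_sub]
    rw [show (1 - x) * (1 - (1 - x)) = x * (1 - x) by ring]
  have hcvx : ConvexOn ℝ (Set.Icc ((1 - τ) / 2) ((1 + τ) / 2)) G := by
    refine convexOn_of_hasDerivWithinAt2_nonneg (convex_Icc _ _) hGc.continuousOn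
      (f' := fun p => L * ((1 - 2 * p) / √(p * (1 - p))) - (log (1 - p) - log p))
      (f'' := fun p => (2 * √(p * (1 - p)) - L) / (2 * √(p * (1 - p)) ^ 3)) ?_ ?_ ?_
    all_goals
      intro x hx
      rw [interior_Icc] at hx
      have hx0 : 0 < x := by linarith [hx.1]
      have hx1 : x < 1 := by linarith [hx.2]
    · exact (aux_deriv1 x hx0 hx1).hasDerivWithinAt
    · exact (aux_deriv2 x hx0 hx1).hasDerivWithinAt
    · apply div_nonneg _ (by positivity)
      have : L / 2 ≤ √(x * (1 - x)) := by
        apply Real.le_sqrt_of_sq_le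
        nlinarith [hx.1, hx.2, mul_pos (sub_pos.2 hx.1) (sub_pos.2 hx.2)]
      linarith
  have hccv : ConcaveOn ℝ (Set.Icc 0 ((1 - τ) / 2)) G := by
    refine concaveOn_of_hasDerivWithinAt2_nonpos (convex_Icc _ _) hGc.continuousOn
      (f' := fun p => L * ((1 - 2 * p) / √(p * (1 - p))) - (log (1 - p) - log p))
      (f'' := fun p => (2 * √(p * (1 - p)) - L) / (2 * √(p * (1 - p)) ^ 3)) ?_ ?_ ?_
    all_goals
      intro x hx
      rw [interior_Icc] at hx
      have hx0 : 0 < x := by linarith [hx.1]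
      have hx1 : x < 1 := by linarith [hx.2]
    · exact (aux_deriv1 x hx0 hx1).hasDerivWithinAt
    · exact (aux_deriv2 x hx0 hx1).hasDerivWithinAt
    · apply div_nonpos_of_nonpos_of_nonneg _ (by positivity)
      have : √(x * (1 - x)) ≤ L / 2 := by
        apply Real.sqrt_le_iff.2 ⟨by positivity, ?_⟩
        nlinarith [hx.1, hx.2, mul_pos (sub_pos.2 hx.2)
          (show 0 < (1 + τ) / 2 - x by linarith [hx.2])]
      linarith
  have hmid : ∀ x, (1 - τ) / 2 ≤ x → x ≤ 1 / 2 → 0 ≤ G x := by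
    intro x h1 h2
    have := hcvx.2 (show x ∈ _ from ⟨h1, by linarith⟩)
      (show 1 - x ∈ _ from ⟨by linarith, by linarith⟩)
      (show (0 : ℝ) ≤ 1 / 2 by norm_num) (show (0 : ℝ) ≤ 1 / 2 by norm_num) (by norm_num)
    rw [hsymm] at this
    simp only [smul_eq_mul] at this
    rw [show 1 / 2 * x + 1 / 2 * (1 - x) = 1 / 2 by ring, hhalf] at this
    linarith
  have : 0 ≤ G p := by
    rcases le_total ((1 - τ) / 2) p with h | h
    · exact hmid p h hp1
    · have h2 := hmid ((1 - τ) / 2) le_rfl (by linarith)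
      have h3 := hccv.min_le_of_mem_Icc (x := 0) (y := (1 - τ) / 2) (z := p)
        ⟨le_rfl, by linarith⟩ ⟨by linarith, le_rfl⟩ ⟨hp0, h⟩
      rw [hzero, min_eq_left h2] at h3
      exact h3
  simp only [hG] at this
  linarith

lemma aux_h2_symm (p : ℝ) : h2 (1 - p) = h2 p := by
  rw [aux_h2_eq, aux_h2_eq, Real.binEntropy_one_sub]

lemma aux_h2_nonneg (p : ℝ) (h0 : 0 ≤ p) (h1 : p ≤ 1) : 0 ≤ h2 p := by
  rw [aux_h2_eq]
  exact div_nonneg (Real.binEntropy_nonneg h0 h1) (Real.log_pos (by norm_num)).le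

lemma aux_h2_le_one (p : ℝ) : h2 p ≤ 1 := by
  rw [aux_h2_eq, div_le_one (Real.log_pos (by norm_num))]
  exact Real.binEntropy_le_log_two

lemma aux_h2_sq (p : ℝ) (h0 : 0 ≤ p) (h1 : p ≤ 1) : h2 p ^ 2 ≤ 1 - (1 - 2 * p) ^ 2 := by
  wlog hp : p ≤ 1 / 2 generalizing p with H
  · have := H (1 - p) (by linarith) (by linarith) (by linarith)
    rw [aux_h2_symm] at this
    linarith
  have hL0 : 0 < Real.log 2 := Real.log_pos (by norm_num)
  have h := aux_ent_le p h0 hp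
  have h' : h2 p ≤ 2 * √(p * (1 - p)) := by
    rw [aux_h2_eq, div_le_iff₀ hL0]; linarith
  have hn := aux_h2_nonneg p h0 h1
  have hs : √(p * (1 - p)) ^ 2 = p * (1 - p) :=
    Real.sq_sqrt (mul_nonneg h0 (by linarith))
  nlinarith

lemma aux_contr_h2 (p q : ℝ) (hp : p ∈ Set.Icc (0 : ℝ) 1) (hq : q ∈ Set.Icc (0 : ℝ) 1) :
    1 - h2 (bconv p q) ≤ (1 - 2 * q) ^ 2 * (1 - h2 p) := by
  have hL0 : 0 < Real.log 2 := Real.log_pos (by norm_num)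
  have h := aux_contr (1 - 2 * p) (1 - 2 * q)
    (abs_le.2 ⟨by linarith [hp.2], by linarith [hp.1]⟩)
    (abs_le.2 ⟨by linarith [hq.2], by linarith [hq.1]⟩)
  rw [show (1 - (1 - 2 * q) * (1 - 2 * p)) / 2 = bconv p q by unfold bconv; ring,
    show (1 - (1 - 2 * p)) / 2 = p by ring] at h
  have e : ∀ x, Real.binEntropy x = h2 x * Real.log 2 := fun x => by
    rw [aux_h2_eq]; field_simp
  rw [e, e] at h
  refine le_of_mul_le_mul_right ?_ hL0
  linarith

lemma aux_bconv_comm (p q : ℝ) : bconv p q = bconv q p := by unfold bconv; ring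

lemma aux_pointwise (p q : ℝ) (hp : p ∈ Set.Icc (0 : ℝ) 1) (hq : q ∈ Set.Icc (0 : ℝ) 1) :
    1 - h2 (bconv p q) ≤
      (1 - h2 p) * (1 - h2 q) * (2 - ((1 - h2 p) + (1 - h2 q)) / 2) := by
  wlog hpq : 1 - h2 p ≤ 1 - h2 q generalizing p q with H
  · have := H q p hq hp (le_of_not_ge hpq)
    rw [aux_bconv_comm] at this
    linarith
  have h1 := aux_contr_h2 p q hp hq
  have h2' := aux_h2_sq q hq.1 hq.2
  have hu := aux_h2_le_one p
  have hv := aux_h2_le_one q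
  set u := 1 - h2 p
  set v := 1 - h2 q with hvd
  have hu0 : 0 ≤ u := by linarith
  have hv0 : 0 ≤ v := by linarith
  have h3 : (1 - 2 * q) ^ 2 ≤ v * (2 - (u + v) / 2) := by
    have : h2 q = 1 - v := by rw [hvd]; ring
    rw [this] at h2'
    nlinarith
  nlinarith [mul_le_mul_of_nonneg_right h3 hu0]

lemma aux_jensen {Y : Type*} [Fintype Y] (P : Y → ℝ) (hP : ∀ y, 0 ≤ P y)
    (hs : ∑ y, P y = 1) (u : Y → ℝ) (m : ℝ) (hm : ∑ y, P y * u y = m) :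
    m ^ 2 ≤ ∑ y, P y * u y ^ 2 := by
  have h : 0 ≤ ∑ y, P y * (u y - m) ^ 2 :=
    Finset.sum_nonneg fun y _ => mul_nonneg (hP y) (sq_nonneg _)
  have e : ∑ y, P y * (u y - m) ^ 2
      = ∑ y, P y * u y ^ 2 - 2 * m * ∑ y, P y * u y + m ^ 2 * ∑ y, P y := by
    rw [Finset.mul_sum, Finset.mul_sum, ← Finset.sum_sub_distrib, ← Finset.sum_add_distrib]
    exact Finset.sum_congr rfl fun y _ => by ring
  rw [e, hm, hs] at h
  linarith

theorem T2_gap_condition {Y₁ Y₂ : Type*} [Fintype Y₁] [Fintype Y₂]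
    (P₁ : Y₁ → ℝ) (hP₁ : ∀ y, 0 ≤ P₁ y) (hP₁sum : ∑ y, P₁ y = 1)
    (P₂ : Y₂ → ℝ) (hP₂ : ∀ y, 0 ≤ P₂ y) (hP₂sum : ∑ y, P₂ y = 1)
    (q₁ : Y₁ → ℝ) (hq₁ : ∀ y, q₁ y ∈ Set.Icc (0 : ℝ) 1)
    (q₂ : Y₂ → ℝ) (hq₂ : ∀ y, q₂ y ∈ Set.Icc (0 : ℝ) 1)
    (a : ℝ) (ha : a ∈ Set.Icc (0 : ℝ) (1 / 2))
    (hEq₁ : h2 a = ∑ y, P₁ y * h2 (q₁ y))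
    (hEq₂ : h2 a = ∑ y, P₂ y * h2 (q₂ y)) :
    ∑ y₁, ∑ y₂, P₁ y₁ * P₂ y₂ * h2 (bconv (q₁ y₁) (q₂ y₂)) ≥
      h2 a + (h2 a) ^ 2 * (1 - h2 a) := by
  have ha1 := aux_h2_le_one a
  obtain ⟨m, hm⟩ : ∃ m, m = 1 - h2 a := ⟨_, rfl⟩
  have hu : ∑ y, P₁ y * (1 - h2 (q₁ y)) = m := by
    simp only [mul_sub, mul_one, Finset.sum_sub_distrib, hP₁sum, ← hEq₁, hm]
  have hv : ∑ y, P₂ y * (1 - h2 (q₂ y)) = m := by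
    simp only [mul_sub, mul_one, Finset.sum_sub_distrib, hP₂sum, ← hEq₂, hm]
  have hu2 := aux_jensen P₁ hP₁ hP₁sum _ m hu
  have hv2 := aux_jensen P₂ hP₂ hP₂sum _ m hv
  have hle : ∑ y₁, ∑ y₂, P₁ y₁ * P₂ y₂ *
      (1 - (1 - h2 (q₁ y₁)) * (1 - h2 (q₂ y₂)) *
        (2 - ((1 - h2 (q₁ y₁)) + (1 - h2 (q₂ y₂))) / 2)) ≤
      ∑ y₁, ∑ y₂, P₁ y₁ * P₂ y₂ * h2 (bconv (q₁ y₁) (q₂ y₂)) := by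
    refine Finset.sum_le_sum fun y₁ _ => Finset.sum_le_sum fun y₂ _ => ?_
    refine mul_le_mul_of_nonneg_left ?_ (mul_nonneg (hP₁ _) (hP₂ _))
    linarith [aux_pointwise (q₁ y₁) (q₂ y₂) (hq₁ _) (hq₂ _)]
  have heq : ∑ y₁, ∑ y₂, P₁ y₁ * P₂ y₂ *
      (1 - (1 - h2 (q₁ y₁)) * (1 - h2 (q₂ y₂)) *
        (2 - ((1 - h2 (q₁ y₁)) + (1 - h2 (q₂ y₂))) / 2)) =
      (∑ y, P₁ y) * (∑ y, P₂ y)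
      - 2 * ((∑ y, P₁ y * (1 - h2 (q₁ y))) * (∑ y, P₂ y * (1 - h2 (q₂ y))))
      + 1 / 2 * ((∑ y, P₁ y * (1 - h2 (q₁ y)) ^ 2) * (∑ y, P₂ y * (1 - h2 (q₂ y))))
      + 1 / 2 * ((∑ y, P₁ y * (1 - h2 (q₁ y))) * (∑ y, P₂ y * (1 - h2 (q₂ y)) ^ 2)) := by
    simp only [Finset.sum_mul_sum]
    simp only [Finset.mul_sum, ← Finset.sum_sub_distrib,
      ← Finset.sum_add_distrib]
    exact Finset.sum_congr rfl fun y₁ _ => Finset.sum_congr rfl fun y₂ _ => by ring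
  rw [heq, hu, hv, hP₁sum, hP₂sum] at hle
  have hm0 : 0 ≤ m := by linarith
  have hh : h2 a = 1 - m := by linarith
  rw [hh]
  nlinarith [mul_le_mul_of_nonneg_right hu2 hm0, mul_le_mul_of_nonneg_right hv2 hm0]
end

section
/- Let Y₁, Y₂, Y₃ be finite types, let P₁, P₂, P₃ be probability mass functions on them, let q₁ : Y₁ → [0,1], q₂ : Y₂ → [0,1], q₃ : Y₃ → [0,1], and let a ∈ [0,1/2] be such that H₀ := h₂(a) = ∑_{y_i} P_i(y_i)·h₂(q_i(y_i)) for each i ∈ {1,2,3}. Then ∑_{y₁} ∑_{y₂} ∑_{y₃} P₁(y₁)·P₂(y₂)·P₃(y₃)·h₂(q₁(y₁)⋆q₂(y₂)⋆q₃(y₃)) ≥ H₀ + H₀²·(1 − H₀)². -/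
lemma h2_eq (p : ℝ) : Real.log 2 * h2 p = Real.binEntropy p := by
  have hL : Real.log 2 ≠ 0 := (Real.log_pos (by norm_num)).ne'
  unfold h2 Real.binEntropy Real.logb
  rw [Real.log_inv, Real.log_inv]
  field_simp
  ring

lemma log_le_half {y : ℝ} (hy : 1 ≤ y) : Real.log y ≤ (y - y⁻¹) / 2 := by
  have h := Real.self_le_sinh_iff.2 (Real.log_nonneg hy)
  rwa [Real.sinh_log (by linarith)] at h

lemma factA_aux {p : ℝ} (h0 : 0 ≤ p) (h1 : p ≤ 1 / 2) :
    Real.log 2 - Real.binEntropy p ≤ 3 / 4 * (1 - 2 * p) ^ 2 := by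
  have e1 : (1 - p) * Real.log (2 * (1 - p)) ≤ (1 - p) * ((2 * (1 - p) - (2 * (1 - p))⁻¹) / 2) :=
    mul_le_mul_of_nonneg_left (log_le_half (by linarith)) (by linarith)
  have e1' : (1 - p) * ((2 * (1 - p) - (2 * (1 - p))⁻¹) / 2) = (1 - p) ^ 2 - 1 / 4 := by
    have : (1 - p) ≠ 0 := by linarith
    field_simp
    ring
  have l1 : Real.log (2 * (1 - p)) = Real.log 2 + Real.log (1 - p) :=
    Real.log_mul (by norm_num) (by linarith)
  have e2 : p * (Real.log 2 + Real.log p) ≤ p * (2 * p - 1) := by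
    rcases h0.eq_or_lt with h | h
    · simp [← h]
    · rw [← Real.log_mul (by norm_num) h.ne']
      exact mul_le_mul_of_nonneg_left (Real.log_le_sub_one_of_pos (by linarith)) h0
  rw [e1', l1] at e1
  unfold Real.binEntropy
  rw [Real.log_inv, Real.log_inv]
  nlinarith

lemma factA {p : ℝ} (h0 : 0 ≤ p) (h1 : p ≤ 1) :
    Real.log 2 - Real.binEntropy p ≤ 3 / 4 * (1 - 2 * p) ^ 2 := by
  rcases le_total p (1 / 2) with h | h
  · exact factA_aux h0 h
  · have := factA_aux (p := 1 - p) (by linarith) (by linarith)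
    rw [Real.binEntropy_one_sub] at this
    nlinarith

lemma factB_aux {p : ℝ} (h0 : 0 ≤ p) (h1 : p ≤ 1) :
    p * Real.log p⁻¹ ≤ Real.sqrt p * (1 - p) := by
  rcases h0.eq_or_lt with h | h
  · simp [← h]
  · obtain ⟨u, hu, rfl⟩ : ∃ u : ℝ, 0 < u ∧ p = u ^ 2 :=
      ⟨Real.sqrt p, Real.sqrt_pos.2 h, (Real.sq_sqrt h0).symm⟩
    rw [Real.sqrt_sq hu.le]
    have hu1 : u ≤ 1 := by nlinarith
    have := log_le_half (one_le_inv_iff₀.2 ⟨hu, hu1⟩)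
    rw [← inv_pow, Real.log_pow]
    have h3 : u ^ 2 * (2 * Real.log u⁻¹) ≤ u ^ 2 * (2 * ((u⁻¹ - u⁻¹⁻¹) / 2)) := by gcongr
    have h4 : u ^ 2 * (2 * ((u⁻¹ - u⁻¹⁻¹) / 2)) = u * (1 - u ^ 2) := by
      field_simp
    push_cast
    linarith

lemma factB {p : ℝ} (h0 : 0 ≤ p) (h1 : p ≤ 1) :
    2 * Real.binEntropy p ^ 2 ≤ 1 - (1 - 2 * p) ^ 2 := by
  have a1 := factB_aux h0 h1
  have a2 := factB_aux (p := 1 - p) (by linarith) (by linarith)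
  have hn := Real.binEntropy_nonneg h0 h1
  have hu := Real.sqrt_nonneg p
  have hv := Real.sqrt_nonneg (1 - p)
  have su := Real.sq_sqrt h0
  have sv := Real.sq_sqrt (show 0 ≤ 1 - p by linarith)
  set u := Real.sqrt p
  set v := Real.sqrt (1 - p)
  have hb : Real.binEntropy p ≤ u * v * (u + v) := by
    unfold Real.binEntropy
    have : u * v * (u + v) = u * (v ^ 2) + v * u ^ 2 := by ring
    rw [this, su, sv]
    linarith
  have hsq : Real.binEntropy p ^ 2 ≤ (u * v * (u + v)) ^ 2 := by gcongr
  have h2 : (u + v) ^ 2 ≤ 2 := by nlinarith [sq_nonneg (u - v)]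
  have h3 : (u * v * (u + v)) ^ 2 = p * (1 - p) * (u + v) ^ 2 := by
    rw [← su]
    rw [show 1 - u ^ 2 = v ^ 2 by linarith]
    ring
  have : p * (1 - p) * (u + v) ^ 2 ≤ p * (1 - p) * 2 :=
    mul_le_mul_of_nonneg_left h2 (mul_nonneg h0 (by linarith))
  nlinarith

lemma concF : ConcaveOn ℝ (Set.Icc 0 1)
    (fun p => Real.binEntropy p + (1 - 2 * p) ^ 2 / 2) := by
  have hd : ∀ x ∈ Set.Ioo (0 : ℝ) 1, HasDerivAt
      (fun p => Real.binEntropy p + (1 - 2 * p) ^ 2 / 2)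
      (Real.log (1 - x) - Real.log x - 2 * (1 - 2 * x)) x := by
    intro x hx
    have h1 := Real.hasDerivAt_binEntropy hx.1.ne' hx.2.ne
    have h2 : HasDerivAt (fun p : ℝ => (1 - 2 * p) ^ 2 / 2) (-2 * (1 - 2 * x)) x := by
      have := ((((hasDerivAt_id x).const_mul 2).const_sub 1).pow 2).div_const 2
      refine this.congr_deriv ?_
      simp
      ring
    exact (h1.add h2).congr_deriv (by ring)
  have hd2 : ∀ x ∈ Set.Ioo (0 : ℝ) 1, HasDerivAt
      (fun x => Real.log (1 - x) - Real.log x - 2 * (1 - 2 * x))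
      (-1 / (1 - x) - 1 / x + 4) x := by
    intro x hx
    have h1 := ((hasDerivAt_id x).const_sub 1).log (by simpa using (sub_pos.2 hx.2).ne')
    have h2 := (hasDerivAt_id x).log hx.1.ne'
    have h3 := ((((hasDerivAt_id x).const_mul 2).const_sub 1)).const_mul 2
    refine ((h1.sub h2).sub h3).congr_deriv ?_
    simp
    ring
  refine concaveOn_of_hasDerivWithinAt2_nonpos (convex_Icc 0 1)
    (f' := fun x => Real.log (1 - x) - Real.log x - 2 * (1 - 2 * x))
    (f'' := fun x => -1 / (1 - x) - 1 / x + 4) ?_ ?_ ?_ ?_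
  · have := Real.binEntropy_continuous
    fun_prop
  · intro x hx
    rw [interior_Icc] at hx
    exact (hd x hx).hasDerivWithinAt
  · intro x hx
    rw [interior_Icc] at hx
    exact (hd2 x hx).hasDerivWithinAt
  · intro x hx
    rw [interior_Icc] at hx
    have h0 := hx.1
    have h1 : 0 < 1 - x := sub_pos.2 hx.2
    have : -1 / (1 - x) - 1 / x + 4 = -(1 - 2 * x) ^ 2 / ((1 - x) * x) := by
      field_simp
      ring
    change -1 / (1 - x) - 1 / x + 4 ≤ 0
    rw [this]
    exact div_nonpos_of_nonpos_of_nonneg (by nlinarith [sq_nonneg (1 - 2 * x)]) (by positivity)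

lemma bconv_mem {p b : ℝ} (hp : p ∈ Set.Icc (0 : ℝ) 1) (hb : b ∈ Set.Icc (0 : ℝ) 1) :
    bconv p b ∈ Set.Icc (0 : ℝ) 1 := by
  obtain ⟨p0, p1⟩ := hp
  obtain ⟨b0, b1⟩ := hb
  unfold bconv
  constructor <;> nlinarith [mul_nonneg p0 b0, mul_nonneg p0 (sub_nonneg.2 b1),
    mul_nonneg b0 (sub_nonneg.2 p1), mul_nonneg (sub_nonneg.2 p1) (sub_nonneg.2 b1)]

lemma factC {p b : ℝ} (hp : p ∈ Set.Icc (0 : ℝ) 1) (hb : b ∈ Set.Icc (0 : ℝ) 1) :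
    Real.binEntropy p + (1 - 2 * p) ^ 2 / 2 ≤
      Real.binEntropy (bconv p b) + (1 - 2 * bconv p b) ^ 2 / 2 := by
  have hp' : 1 - p ∈ Set.Icc (0 : ℝ) 1 := ⟨by linarith [hp.2], by linarith [hp.1]⟩
  have hb' : 0 ≤ 1 - b := by linarith [hb.2]
  have hab : 1 - b + b = 1 := by ring
  have := concF.2 hp hp' hb' hb.1 hab
  simp only [smul_eq_mul, Real.binEntropy_one_sub] at this
  rw [show (1 - b) * p + b * (1 - p) = bconv p b by unfold bconv; ring] at this
  nlinarith

lemma avgA {Y : Type*} [Fintype Y] (P q : Y → ℝ) (hP : ∀ y, 0 ≤ P y) (hs : ∑ y, P y = 1)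
    (hq : ∀ y, q y ∈ Set.Icc (0 : ℝ) 1) :
    Real.log 2 - ∑ y, P y * Real.binEntropy (q y) ≤ 3 / 4 * ∑ y, P y * (1 - 2 * q y) ^ 2 := by
  have : ∑ y, P y * (Real.log 2 - Real.binEntropy (q y)) ≤
      ∑ y, P y * (3 / 4 * (1 - 2 * q y) ^ 2) :=
    Finset.sum_le_sum fun y _ => mul_le_mul_of_nonneg_left (factA (hq y).1 (hq y).2) (hP y)
  simp only [mul_sub, Finset.sum_sub_distrib, ← Finset.sum_mul, hs, one_mul] at this
  rw [Finset.mul_sum]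
  refine this.trans (le_of_eq ?_)
  exact Finset.sum_congr rfl fun y _ => by ring

lemma avgB {Y : Type*} [Fintype Y] (P q : Y → ℝ) (hP : ∀ y, 0 ≤ P y) (hs : ∑ y, P y = 1)
    (hq : ∀ y, q y ∈ Set.Icc (0 : ℝ) 1) :
    2 * (∑ y, P y * Real.binEntropy (q y)) ^ 2 ≤ 1 - ∑ y, P y * (1 - 2 * q y) ^ 2 := by
  set E := ∑ y, P y * Real.binEntropy (q y) with hE
  have : ∑ y, P y * (4 * E * Real.binEntropy (q y) - 2 * E ^ 2) ≤
      ∑ y, P y * (1 - (1 - 2 * q y) ^ 2) :=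
    Finset.sum_le_sum fun y _ => mul_le_mul_of_nonneg_left
      (by nlinarith [factB (hq y).1 (hq y).2, sq_nonneg (Real.binEntropy (q y) - E)]) (hP y)
  have e1 : ∑ y, P y * (4 * E * Real.binEntropy (q y) - 2 * E ^ 2) = 4 * E * E - 2 * E ^ 2 := by
    simp only [mul_sub, Finset.sum_sub_distrib, ← Finset.sum_mul, hs, one_mul]
    congr 1
    have : ∀ y, P y * (4 * E * Real.binEntropy (q y)) =
        4 * E * (P y * Real.binEntropy (q y)) := fun y => by ring
    simp only [this]
    rw [← Finset.mul_sum]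
  have e2 : ∑ y, P y * (1 - (1 - 2 * q y) ^ 2) = 1 - ∑ y, P y * (1 - 2 * q y) ^ 2 := by
    simp only [mul_sub, Finset.sum_sub_distrib, mul_one, hs]
  rw [e1, e2] at this
  nlinarith

lemma final_ineq {L H S m1 m2 m3 : ℝ} (hL1 : 0.693 ≤ L) (hL2 : L ≤ 0.694)
    (H0 : 0 ≤ H) (H1 : H ≤ 1) (m20 : 0 ≤ m2) (m30 : 0 ≤ m3)
    (hA : L * (1 - H) ≤ 3 / 4 * m1) (hB2 : 2 * (L * H) ^ 2 ≤ 1 - m2)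
    (hB3 : 2 * (L * H) ^ 2 ≤ 1 - m3)
    (hC : L * H + m1 / 2 ≤ L * S + m1 * m2 * m3 / 2) :
    H + H ^ 2 * (1 - H) ^ 2 ≤ S := by
  have hL0 : 0 < L := by linarith
  have q1 : 0.48 ≤ L ^ 2 := by nlinarith
  have q2 : L ^ 2 ≤ 0.49 := by nlinarith
  set w := 2 * (L * H) ^ 2 with hw
  have hw0 : 0 ≤ w := by positivity
  have hw1 : w ≤ 1 := by linarith
  have hm : m2 * m3 ≤ (1 - w) * (1 - w) :=
    mul_le_mul (by linarith) (by linarith) m30 (by linarith)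
  have hG : 0 ≤ 1 - H := by linarith
  have k1 : w * (2 - w) ≤ 1 - m2 * m3 := by nlinarith
  have k0 : 0 ≤ w * (2 - w) := mul_nonneg hw0 (by linarith)
  have k2 : 4 / 3 * (L * (1 - H)) * (w * (2 - w)) ≤ m1 * (1 - m2 * m3) :=
    mul_le_mul (by linarith) k1 k0 (by nlinarith)
  have k3 : 1 - H ≤ 8 / 3 * L ^ 2 * (1 - L ^ 2 * H ^ 2) := by
    have : 0.51 * H ^ 2 + (1 - H ^ 2) ≤ 1 - L ^ 2 * H ^ 2 := by nlinarith [sq_nonneg H]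
    have h5 : 8 / 3 * 0.48 * (0.51 * H ^ 2 + (1 - H ^ 2)) ≤
        8 / 3 * L ^ 2 * (1 - L ^ 2 * H ^ 2) := by
      apply mul_le_mul (by linarith) this (by nlinarith) (by positivity)
    nlinarith
  have k4 : L * ((1 - H) * H ^ 2) * (1 - H) ≤
      L * ((1 - H) * H ^ 2) * (8 / 3 * L ^ 2 * (1 - L ^ 2 * H ^ 2)) :=
    mul_le_mul_of_nonneg_left k3 (by positivity)
  have k5 : 4 / 3 * (L * (1 - H)) * (w * (2 - w)) =
      2 * (L * ((1 - H) * H ^ 2) * (8 / 3 * L ^ 2 * (1 - L ^ 2 * H ^ 2))) := by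
    rw [hw]; ring
  have k6 : L * (H + H ^ 2 * (1 - H) ^ 2) ≤ L * S := by nlinarith
  exact le_of_mul_le_mul_left k6 hL0

theorem T3_first_gap_condition {Y₁ Y₂ Y₃ : Type*} [Fintype Y₁] [Fintype Y₂] [Fintype Y₃]
    (P₁ : Y₁ → ℝ) (hP₁ : ∀ y, 0 ≤ P₁ y) (hP₁sum : ∑ y, P₁ y = 1)
    (P₂ : Y₂ → ℝ) (hP₂ : ∀ y, 0 ≤ P₂ y) (hP₂sum : ∑ y, P₂ y = 1)
    (P₃ : Y₃ → ℝ) (hP₃ : ∀ y, 0 ≤ P₃ y) (hP₃sum : ∑ y, P₃ y = 1)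
    (q₁ : Y₁ → ℝ) (hq₁ : ∀ y, q₁ y ∈ Set.Icc (0 : ℝ) 1)
    (q₂ : Y₂ → ℝ) (hq₂ : ∀ y, q₂ y ∈ Set.Icc (0 : ℝ) 1)
    (q₃ : Y₃ → ℝ) (hq₃ : ∀ y, q₃ y ∈ Set.Icc (0 : ℝ) 1)
    (a : ℝ) (ha : a ∈ Set.Icc (0 : ℝ) (1 / 2))
    (hEq₁ : h2 a = ∑ y, P₁ y * h2 (q₁ y))
    (hEq₂ : h2 a = ∑ y, P₂ y * h2 (q₂ y))
    (hEq₃ : h2 a = ∑ y, P₃ y * h2 (q₃ y)) :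
    ∑ y₁, ∑ y₂, ∑ y₃, P₁ y₁ * P₂ y₂ * P₃ y₃ *
        h2 (bconv (q₁ y₁) (bconv (q₂ y₂) (q₃ y₃))) ≥
      h2 a + (h2 a) ^ 2 * (1 - h2 a) ^ 2 := by
  have hL1 := Real.log_two_gt_d9
  have hL2 := Real.log_two_lt_d9
  have hL0 : 0 < Real.log 2 := by linarith
  have H0 : 0 ≤ h2 a := by
    have := Real.binEntropy_nonneg ha.1 (by linarith [ha.2])
    rw [← h2_eq] at this
    exact nonneg_of_mul_nonneg_right this hL0
  have H1 : h2 a ≤ 1 := by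
    have := Real.binEntropy_le_log_two (p := a)
    rw [← h2_eq] at this
    exact le_of_mul_le_mul_left (by linarith) hL0
  have c1 : Real.log 2 * h2 a = ∑ y, P₁ y * Real.binEntropy (q₁ y) := by
    rw [hEq₁, Finset.mul_sum]
    exact Finset.sum_congr rfl fun y _ => by rw [← h2_eq]; ring
  have c2 : Real.log 2 * h2 a = ∑ y, P₂ y * Real.binEntropy (q₂ y) := by
    rw [hEq₂, Finset.mul_sum]
    exact Finset.sum_congr rfl fun y _ => by rw [← h2_eq]; ring
  have c3 : Real.log 2 * h2 a = ∑ y, P₃ y * Real.binEntropy (q₃ y) := by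
    rw [hEq₃, Finset.mul_sum]
    exact Finset.sum_congr rfl fun y _ => by rw [← h2_eq]; ring
  have A := avgA P₁ q₁ hP₁ hP₁sum hq₁
  have B2 := avgB P₂ q₂ hP₂ hP₂sum hq₂
  have B3 := avgB P₃ q₃ hP₃ hP₃sum hq₃
  rw [← c1] at A
  rw [← c2] at B2
  rw [← c3] at B3
  refine final_ineq (L := Real.log 2) (m1 := ∑ y, P₁ y * (1 - 2 * q₁ y) ^ 2)
    (m2 := ∑ y, P₂ y * (1 - 2 * q₂ y) ^ 2) (m3 := ∑ y, P₃ y * (1 - 2 * q₃ y) ^ 2)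
    (by linarith) (by linarith) H0 H1
    (Finset.sum_nonneg fun y _ => mul_nonneg (hP₂ y) (sq_nonneg _))
    (Finset.sum_nonneg fun y _ => mul_nonneg (hP₃ y) (sq_nonneg _))
    (by linarith) B2 B3 ?_
  have key : ∑ y₁, ∑ y₂, ∑ y₃, P₁ y₁ * P₂ y₂ * P₃ y₃ *
        (Real.binEntropy (q₁ y₁) + (1 - 2 * q₁ y₁) ^ 2 / 2) ≤
      ∑ y₁, ∑ y₂, ∑ y₃, P₁ y₁ * P₂ y₂ * P₃ y₃ *
        (Real.log 2 * h2 (bconv (q₁ y₁) (bconv (q₂ y₂) (q₃ y₃))) +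
          (1 - 2 * q₁ y₁) ^ 2 * (1 - 2 * q₂ y₂) ^ 2 * (1 - 2 * q₃ y₃) ^ 2 / 2) := by
    refine Finset.sum_le_sum fun y₁ _ => Finset.sum_le_sum fun y₂ _ =>
      Finset.sum_le_sum fun y₃ _ => mul_le_mul_of_nonneg_left ?_
        (mul_nonneg (mul_nonneg (hP₁ y₁) (hP₂ y₂)) (hP₃ y₃))
    refine (factC (hq₁ y₁) (bconv_mem (hq₂ y₂) (hq₃ y₃))).trans (le_of_eq ?_)
    rw [h2_eq]
    congr 1
    unfold bconv
    ring
  have e1 : ∑ y₁, ∑ y₂, ∑ y₃, P₁ y₁ * P₂ y₂ * P₃ y₃ *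
        (Real.binEntropy (q₁ y₁) + (1 - 2 * q₁ y₁) ^ 2 / 2) =
      Real.log 2 * h2 a + (∑ y, P₁ y * (1 - 2 * q₁ y) ^ 2) / 2 := by
    rw [c1, Finset.sum_div, ← Finset.sum_add_distrib]
    refine Finset.sum_congr rfl fun y₁ _ => ?_
    simp only [← Finset.sum_mul, ← Finset.mul_sum, hP₂sum, hP₃sum]
    ring
  have e2 : ∑ y₁, ∑ y₂, ∑ y₃, P₁ y₁ * P₂ y₂ * P₃ y₃ *
        (Real.log 2 * h2 (bconv (q₁ y₁) (bconv (q₂ y₂) (q₃ y₃))) +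
          (1 - 2 * q₁ y₁) ^ 2 * (1 - 2 * q₂ y₂) ^ 2 * (1 - 2 * q₃ y₃) ^ 2 / 2) =
      Real.log 2 * (∑ y₁, ∑ y₂, ∑ y₃, P₁ y₁ * P₂ y₂ * P₃ y₃ *
        h2 (bconv (q₁ y₁) (bconv (q₂ y₂) (q₃ y₃)))) +
      (∑ y, P₁ y * (1 - 2 * q₁ y) ^ 2) * (∑ y, P₂ y * (1 - 2 * q₂ y) ^ 2) *
        (∑ y, P₃ y * (1 - 2 * q₃ y) ^ 2) / 2 := by
    simp only [mul_add, Finset.sum_add_distrib]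
    congr 1
    · simp only [Finset.mul_sum]
      exact Finset.sum_congr rfl fun y₁ _ => Finset.sum_congr rfl fun y₂ _ =>
        Finset.sum_congr rfl fun y₃ _ => by ring
    · rw [mul_assoc, Finset.sum_mul_sum, Finset.sum_mul, Finset.sum_div]
      refine Finset.sum_congr rfl fun y₁ _ => ?_
      rw [Finset.mul_sum, Finset.sum_div]
      refine Finset.sum_congr rfl fun y₂ _ => ?_
      rw [Finset.mul_sum, Finset.sum_div]
      exact Finset.sum_congr rfl fun y₃ _ => by ring
  rw [e1, e2] at key
  exact key
end
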